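/- Let A be a C*-algebra. The following are equivalent: (i) for every Hilbert A-module M and every Hilbert A-submodule N of M there exists an isometric A-linear embedding φ : N' → M' such that φ(⟨·,n⟩_N) = ⟨·,n⟩_M for every n ∈ N (i.e. φ extends the canonical embedding of N into M'); (ii) for every Hilbert A-module M and every Hilbert A-submodule N of M, every bounded A-linear map r : N → A extends to a bounded A-linear map r' : M → A with ‖r'‖ = ‖r‖, r'|_N = r, and r'(x) = 0 for all x ∈ N^⊥. -/

import Mathlib

noncomputable section

open scoped ENNReal MultiplierAlgebra

universe u v w

/-- A (left) Hilbert C*-module over a (not necessarily unital) C*-algebra `A`: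
a Banach space `M` which is a (nonunital) left `A`-module equipped with an `A`-valued
inner product, `A`-linear in the first variable, satisfying `⟨x,y⟩ = ⟨y,x⟩*`,
`⟨x,x⟩ ≥ 0` (i.e. of the form `b* b`), definiteness, and such that the norm of `M`
satisfies `‖x‖ = ‖⟨x,x⟩‖ ^ (1/2)` and `M` is complete. -/
class HilbertCStarModule (A : Type u) (M : Type v) [NonUnitalCStarAlgebra A]
    [NormedAddCommGroup M] [NormedSpace ℂ M] [SMul A M] where
  inner : M → M → A
  smul_add' : ∀ (a : A) (x y : M), a • (x + y) = a • x + a • y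
  add_smul' : ∀ (a b : A) (x : M), (a + b) • x = a • x + b • x
  mul_smul' : ∀ (a b : A) (x : M), (a * b) • x = a • (b • x)
  smul_smul' : ∀ (c : ℂ) (a : A) (x : M), (c • a) • x = c • (a • x)
  inner_add_left : ∀ x y z : M, inner (x + y) z = inner x z + inner y z
  inner_smulA_left : ∀ (a : A) (x y : M), inner (a • x) y = a * inner x y
  inner_smulC_left : ∀ (c : ℂ) (x y : M), inner (c • x) y = c • inner x y
  inner_conj : ∀ x y : M, inner x y = star (inner y x)
  inner_self_pos : ∀ x : M, ∃ b : A, inner x x = star b * b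
  inner_self_eq_zero : ∀ x : M, inner x x = 0 ↔ x = 0
  norm_eq : ∀ x : M, ‖x‖ = Real.sqrt ‖inner x x‖
  complete : CompleteSpace M

section Defs

variable (A : Type u) [NonUnitalCStarAlgebra A] {M : Type v}
  [NormedAddCommGroup M] [NormedSpace ℂ M] [SMul A M]

/-- The `A`-valued inner product of a Hilbert C*-module. -/
def hInner [HilbertCStarModule A M] (x y : M) : A := HilbertCStarModule.inner x y

/-- The orthogonal complement `S^⊥ = {x | ⟨x, s⟩ = 0 for all s ∈ S}` of a subset `S`. -/
def orthComp [HilbertCStarModule A M] (S : Set M) : Set M :=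
  {x : M | ∀ s ∈ S, hInner A x s = 0}

/-- A Hilbert C*-submodule: a norm-closed subset which is closed under addition and under
the actions of `ℂ` and `A`. -/
structure IsHilbertSubmodule (N : Set M) : Prop where
  isClosed : IsClosed N
  zero_mem : (0 : M) ∈ N
  add_mem : ∀ ⦃x y : M⦄, x ∈ N → y ∈ N → x + y ∈ N
  smulC_mem : ∀ (c : ℂ) ⦃x : M⦄, x ∈ N → c • x ∈ N
  smulA_mem : ∀ (a : A) ⦃x : M⦄, x ∈ N → a • x ∈ N

end Defs

section Maps

variable (A : Type u) [NonUnitalCStarAlgebra A] {M : Type v} {M₂ : Type w}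
  [NormedAddCommGroup M] [NormedSpace ℂ M] [SMul A M]
  [NormedAddCommGroup M₂] [NormedSpace ℂ M₂] [SMul A M₂]

/-- A bounded `A`-linear map between (left) normed `A`-modules. -/
structure IsBoundedModuleMap (T : M → M₂) : Prop where
  map_add : ∀ x y : M, T (x + y) = T x + T y
  map_smulC : ∀ (c : ℂ) (x : M), T (c • x) = c • T x
  map_smulA : ∀ (a : A) (x : M), T (a • x) = a • T x
  bound : ∃ C : ℝ, ∀ x : M, ‖T x‖ ≤ C * ‖x‖

/-- The operator norm of a map between normed modules. -/
def opNorm (T : M → M₂) : ℝ :=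
  sInf {c : ℝ | 0 ≤ c ∧ ∀ x : M, ‖T x‖ ≤ c * ‖x‖}

end Maps

section Dual

variable (A : Type u) [NonUnitalCStarAlgebra A] {M : Type v}
  [NormedAddCommGroup M] [NormedSpace ℂ M] [SMul A M]

/-- A bounded `A`-linear map `M → A`, i.e. an element of the `A`-dual `M'`. -/
structure IsDualVector (r : M → A) : Prop where
  map_add : ∀ x y : M, r (x + y) = r x + r y
  map_smulC : ∀ (c : ℂ) (x : M), r (c • x) = c • r x
  map_smulA : ∀ (a : A) (x : M), r (a • x) = a * r x
  bound : ∃ C : ℝ, ∀ x : M, ‖r x‖ ≤ C * ‖x‖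

/-- The norm of an element of the `A`-dual. -/
def dualNorm (r : M → A) : ℝ :=
  sInf {c : ℝ | 0 ≤ c ∧ ∀ x : M, ‖r x‖ ≤ c * ‖x‖}

/-- A function `r : M → A` which restricts to a bounded `A`-linear map on the subset `S`;
this represents an element of the `A`-dual `S'` of the submodule `S` (only the values on `S`
are relevant). -/
structure IsDualVectorOn (S : Set M) (r : M → A) : Prop where
  map_add : ∀ x ∈ S, ∀ y ∈ S, r (x + y) = r x + r y
  map_smulC : ∀ (c : ℂ), ∀ x ∈ S, r (c • x) = c • r x
  map_smulA : ∀ (a : A), ∀ x ∈ S, r (a • x) = a * r x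
  bound : ∃ C : ℝ, ∀ x ∈ S, ‖r x‖ ≤ C * ‖x‖

/-- The norm of a bounded `A`-linear map given on the subset `S`. -/
def dualNormOn (S : Set M) (r : M → A) : ℝ :=
  sInf {c : ℝ | 0 ≤ c ∧ ∀ x ∈ S, ‖r x‖ ≤ c * ‖x‖}

/-- The canonical embedding of `M` into its `A`-dual: `x ↦ ⟨·, x⟩`. -/
def toDualFun [HilbertCStarModule A M] (x : M) : M → A := fun y => hInner A y x

/-- The canonical evaluation map of `M` into its `A`-bidual: `Ω x : r ↦ r x`. -/
def omegaFun (x : M) : (M → A) → A := fun r => r x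

/-- A bounded `A`-linear functional on the `A`-dual `M'`, i.e. an element of the
`A`-bidual `M''`.  Here `M'` carries the `A`-action `(a • r) x = r x * (star a)`, and the
corresponding `A`-linearity for functionals on `M'` reads `F (a • r) = F r * star a`
(which holds for all evaluation functionals `Ω x`). -/
structure IsBidualVector (F : (M → A) → A) : Prop where
  map_add : ∀ r s : M → A, IsDualVector A r → IsDualVector A s →
    F (fun x => r x + s x) = F r + F s
  map_smulC : ∀ (c : ℂ) (r : M → A), IsDualVector A r →
    F (fun x => c • r x) = c • F r
  map_smulA : ∀ (a : A) (r : M → A), IsDualVector A r →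
    F (fun x => r x * star a) = F r * star a
  bound : ∃ C : ℝ, ∀ r : M → A, IsDualVector A r → ‖F r‖ ≤ C * dualNorm A r

/-- The norm of an element of the `A`-bidual. -/
def bidualNorm (F : (M → A) → A) : ℝ :=
  sInf {c : ℝ | 0 ≤ c ∧ ∀ r : M → A, IsDualVector A r → ‖F r‖ ≤ c * dualNorm A r}

/-- An element of the `A`-bidual `S''` of a submodule `S ⊆ M`, represented as a functional
on (representatives of) elements of the `A`-dual `S'`. -/
structure IsBidualVectorOn (S : Set M) (F : (M → A) → A) : Prop where
  congr : ∀ r s : M → A, IsDualVectorOn A S r → IsDualVectorOn A S s →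
    (∀ x ∈ S, r x = s x) → F r = F s
  map_add : ∀ r s : M → A, IsDualVectorOn A S r → IsDualVectorOn A S s →
    F (fun x => r x + s x) = F r + F s
  map_smulC : ∀ (c : ℂ) (r : M → A), IsDualVectorOn A S r →
    F (fun x => c • r x) = c • F r
  map_smulA : ∀ (a : A) (r : M → A), IsDualVectorOn A S r →
    F (fun x => r x * star a) = F r * star a
  bound : ∃ C : ℝ, ∀ r : M → A, IsDualVectorOn A S r → ‖F r‖ ≤ C * dualNormOn A S r

/-- The norm of an element of the `A`-bidual of a submodule `S`. -/
def bidualNormOn (S : Set M) (F : (M → A) → A) : ℝ :=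
  sInf {c : ℝ | 0 ≤ c ∧ ∀ r : M → A, IsDualVectorOn A S r → ‖F r‖ ≤ c * dualNormOn A S r}

/-- `M` is `A`-reflexive if the canonical map `Ω : M → M''` is surjective. -/
def IsCReflexive [HilbertCStarModule A M] : Prop :=
  ∀ F : (M → A) → A, IsBidualVector A F →
    ∃ x : M, ∀ r : M → A, IsDualVector A r → F r = r x

end Dual

section Order

/-- The C*-order relation: `x ≤ y` iff `y - x` is positive, i.e. of the form `c* c`. -/
def cstarLE {B : Type*} [NonUnitalRing B] [Star B] (x y : B) : Prop :=
  ∃ c : B, y - x = star c * c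

/-- `m` is the least upper bound of `S` with respect to the C*-order. -/
def IsCStarLUB {B : Type*} [NonUnitalRing B] [Star B] (S : Set B) (m : B) : Prop :=
  (∀ b ∈ S, cstarLE b m) ∧ ∀ u : B, (∀ b ∈ S, cstarLE b u) → cstarLE m u

/-- A C*-algebra is monotone complete if every norm-bounded increasingly directed set of
self-adjoint elements has a least upper bound. -/
def MonotoneComplete (B : Type*) [NonUnitalNormedRing B] [StarRing B] : Prop :=
  ∀ S : Set B, S.Nonempty → (∀ b ∈ S, star b = b) →
    (∀ x ∈ S, ∀ y ∈ S, ∃ z ∈ S, cstarLE x z ∧ cstarLE y z) →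
    (∃ C : ℝ, ∀ b ∈ S, ‖b‖ ≤ C) →
    ∃ m : B, IsCStarLUB S m

/-- A C*-algebra is additively complete if every family of positive elements whose finite
partial sums are norm-bounded has a least upper bound (of the set of its finite partial
sums). -/
def AdditivelyComplete (B : Type w) [NonUnitalNormedRing B] [StarRing B] : Prop :=
  ∀ (ι : Type w) (f : ι → B), (∀ i, ∃ c : B, f i = star c * c) →
    (∃ C : ℝ, ∀ s : Finset ι, ‖∑ i ∈ s, f i‖ ≤ C) →
    ∃ m : B, IsCStarLUB {b : B | ∃ s : Finset ι, b = ∑ i ∈ s, f i} m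

end Order

/-- The Hahn-Banach type extension property of a C*-algebra `A`: for every Hilbert
`A`-module `M` and every Hilbert `A`-submodule `N ⊆ M`, every bounded `A`-linear map
`r : N → A` extends to a bounded `A`-linear map `r' : M → A` with the same norm, with
`r'` restricted to `N` equal to `r` and `r'` vanishing on `N^⊥`. -/
def ExtensionProperty (A : Type u) [NonUnitalCStarAlgebra A] : Prop :=
  ∀ (M : Type v) [NormedAddCommGroup M] [NormedSpace ℂ M] [SMul A M]
    [HilbertCStarModule A M] (N : Set M), IsHilbertSubmodule A N →
    ∀ r : M → A, IsDualVectorOn A N r →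
      ∃ r' : M → A, IsDualVector A r' ∧ dualNorm A r' = dualNormOn A N r ∧
        (∀ x ∈ N, r' x = r x) ∧ (∀ x ∈ orthComp A N, r' x = 0)

section CStar

theorem mul_star_self_le_smul_of_norm_le_unital {B : Type*} [CStarAlgebra B] [PartialOrder B]
    [StarOrderedRing B] (b h : B) (hh : 0 ≤ h) (K : ℝ)
    (H : ∀ c : B, ‖c * b‖ ^ 2 ≤ K ^ 2 * ‖c * h * star c‖) : b * star b ≤ K ^ 2 • h := by
  have key : ∀ η : ℝ, 0 < η → b * star b ≤ K ^ 2 • (h + algebraMap ℝ B η) := by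
    intro η hη
    set g : B := h + algebraMap ℝ B η with hg
    have hgpos : IsStrictlyPositive g :=
      IsStrictlyPositive.nonneg_add hh (isStrictlyPositive_algebraMap hη)
    have hhg : h ≤ g := by
      rw [hg]; exact le_add_of_nonneg_right (algebraMap_nonneg B hη.le)
    set c : B := g ^ (-(1 / 2) : ℝ) with hc
    have hcsa : star c = c := (CFC.rpow_nonneg (a := g)).isSelfAdjoint
    have hcgc : c * g * c = 1 := CFC.conjugate_rpow_neg_one_half g
    have h1 : c * h * star c ≤ 1 := by
      have := star_right_conjugate_le_conjugate hhg c
      rw [hcsa, hcgc] at this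
      rwa [hcsa]
    have h2 : ‖c * h * star c‖ ≤ 1 :=
      (CStarAlgebra.norm_le_one_iff_of_nonneg _ (star_right_conjugate_nonneg hh c)).2 h1
    have h3 : ‖c * b‖ ^ 2 ≤ K ^ 2 :=
      (H c).trans (mul_le_of_le_one_right (sq_nonneg K) h2)
    have h4 : (c * b) * star (c * b) ≤ algebraMap ℝ B (K ^ 2) := by
      refine CStarAlgebra.mul_star_le_algebraMap_norm_sq.trans ?_
      exact algebraMap_mono B h3
    set d : B := g ^ ((1 / 2) : ℝ) with hd
    have hdsa : star d = d := (CFC.rpow_nonneg (a := g)).isSelfAdjoint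
    have hdc : d * c = 1 := by
      rw [hd, hc, ← CFC.rpow_add hgpos.isUnit]; norm_num [CFC.rpow_zero g hgpos.nonneg]
    have hcd : c * d = 1 := by
      rw [hd, hc, ← CFC.rpow_add hgpos.isUnit]; norm_num [CFC.rpow_zero g hgpos.nonneg]
    have hdd : d * d = g := by
      rw [hd, ← CFC.rpow_add hgpos.isUnit]; norm_num [CFC.rpow_one g hgpos.nonneg]
    have h5 := star_right_conjugate_le_conjugate h4 d
    have e1 : d * (c * b * star (c * b)) * star d = b * star b := by
      rw [star_mul, hcsa, hdsa]
      calc d * (c * b * (star b * c)) * d = (d * c) * (b * star b) * (c * d) := by noncomm_ring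
        _ = _ := by rw [hdc, hcd]; simp
    have e2 : d * algebraMap ℝ B (K ^ 2) * star d = K ^ 2 • g := by
      rw [hdsa, Algebra.algebraMap_eq_smul_one, mul_smul_comm, mul_one, smul_mul_assoc, hdd]
    rwa [e1, e2] at h5
  have lim : Filter.Tendsto (fun η : ℝ => K ^ 2 • (h + algebraMap ℝ B η))
      (nhdsWithin 0 (Set.Ioi 0)) (nhds (K ^ 2 • h)) := by
    have : Continuous (fun η : ℝ => K ^ 2 • (h + algebraMap ℝ B η)) := by
      have := continuous_algebraMap ℝ B
      fun_prop
    have h0 := this.tendsto 0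
    simp only [map_zero, add_zero] at h0
    exact h0.mono_left nhdsWithin_le_nhds
  refine ge_of_tendsto lim ?_
  filter_upwards [self_mem_nhdsWithin] with η hη using key η hη

variable {A : Type*} [NonUnitalCStarAlgebra A] [PartialOrder A] [StarOrderedRing A]

theorem mul_star_self_le_smul_of_norm_le (b h : A) (hh : 0 ≤ h) (K : ℝ)
    (H : ∀ (l : ℂ) (c : A), ‖l • b + c * b‖ ^ 2 ≤
      K ^ 2 * ‖(l * star l) • h + l • (h * star c) + star l • (c * h) + c * h * star c‖) :
    b * star b ≤ K ^ 2 • h := by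
  have hsa : IsSelfAdjoint (b * star b) := IsSelfAdjoint.mul_star_self b
  have hU : (b : Unitization ℂ A) * star (b : Unitization ℂ A) ≤ K ^ 2 • (h : Unitization ℂ A) := by
    refine mul_star_self_le_smul_of_norm_le_unital (b : Unitization ℂ A) (h : Unitization ℂ A)
      (Unitization.inr_nonneg_iff.2 hh) K ?_
    intro c
    induction c using Unitization.ind with
    | _ l c =>
    have e1 : (Unitization.inl l + (c : Unitization ℂ A)) * (b : Unitization ℂ A) =
        ((l • b + c * b : A) : Unitization ℂ A) := by
      simp [add_mul, Unitization.inl_mul_inr]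
    have e2 : (Unitization.inl l + (c : Unitization ℂ A)) * (h : Unitization ℂ A) *
        star (Unitization.inl l + (c : Unitization ℂ A)) =
        (((l * star l) • h + l • (h * star c) + star l • (c * h) + c * h * star c : A) :
          Unitization ℂ A) := by
      simp only [star_add, ← Unitization.inr_star, ← Unitization.inl_star, add_mul, mul_add,
        Unitization.inl_mul_inr, Unitization.inr_mul_inl, Unitization.inr_add,
        ← Unitization.inr_mul, Unitization.inr_smul, smul_smul, mul_comm l, smul_mul_assoc,
]
      abel_nf
    rw [e1, e2, Unitization.norm_inr, Unitization.norm_inr]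
    exact H l c
  have e3 : (b : Unitization ℂ A) * star (b : Unitization ℂ A) =
      ((b * star b : A) : Unitization ℂ A) := by
    simp
  have e4 : K ^ 2 • (h : Unitization ℂ A) = ((K ^ 2 • h : A) : Unitization ℂ A) := by
    rw [Unitization.inr_smul]
  rw [e3, e4] at hU
  exact (Unitization.inr_le_iff _ _ hsa
    (IsSelfAdjoint.smul (by simp [IsSelfAdjoint]) (IsSelfAdjoint.of_nonneg hh))).1 hU
end CStar

/-- An `A`-valued hermitian form on a complex vector space carrying an action of `A` for which
the form is `A`-linear in the first variable. -/
structure HermForm (A : Type*) [NonUnitalCStarAlgebra A] (P : Type*) [AddCommGroup P]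
    [Module ℂ P] where
  act : A → P → P
  ip : P → P → A
  act_zero : ∀ a, act a 0 = 0
  ip_add_left : ∀ x y z, ip (x + y) z = ip x z + ip y z
  ip_smul_left : ∀ (c : ℂ) x y, ip (c • x) y = c • ip x y
  ip_act_left : ∀ (a : A) x y, ip (act a x) y = a * ip x y
  ip_conj : ∀ x y, ip x y = star (ip y x)

namespace HermForm

section Basic
variable {A : Type*} [NonUnitalCStarAlgebra A] {P : Type*} [AddCommGroup P] [Module ℂ P]
  (F : HermForm A P)

theorem ip_add_right (x y z : P) : F.ip x (y + z) = F.ip x y + F.ip x z := by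
  rw [F.ip_conj, F.ip_add_left, star_add, ← F.ip_conj, ← F.ip_conj]

theorem ip_smul_right (c : ℂ) (x y : P) : F.ip x (c • y) = star c • F.ip x y := by
  rw [F.ip_conj, F.ip_smul_left, star_smul, ← F.ip_conj]

theorem ip_act_right (a : A) (x y : P) : F.ip x (F.act a y) = F.ip x y * star a := by
  rw [F.ip_conj, F.ip_act_left, star_mul, ← F.ip_conj]

theorem ip_neg_left (x y : P) : F.ip (-x) y = -F.ip x y := by
  simpa using F.ip_smul_left (-1) x y

theorem ip_neg_right (x y : P) : F.ip x (-y) = -F.ip x y := by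
  simpa using F.ip_smul_right (-1) x y

theorem ip_sub_left (x y z : P) : F.ip (x - y) z = F.ip x z - F.ip y z := by
  rw [sub_eq_add_neg, F.ip_add_left, F.ip_neg_left, ← sub_eq_add_neg]

theorem ip_sub_right (x y z : P) : F.ip x (y - z) = F.ip x y - F.ip x z := by
  rw [sub_eq_add_neg, F.ip_add_right, F.ip_neg_right, ← sub_eq_add_neg]

theorem ip_zero_left (x : P) : F.ip 0 x = 0 := by
  simpa using F.ip_smul_left 0 0 x

theorem ip_zero_right (x : P) : F.ip x 0 = 0 := by
  simpa using F.ip_smul_right 0 x 0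

theorem ip_real_smul_left (c : ℝ) (x y : P) : F.ip ((c : ℂ) • x) y = c • F.ip x y := by
  rw [F.ip_smul_left]; exact Complex.coe_smul c _

theorem ip_real_smul_right (c : ℝ) (x y : P) : F.ip x ((c : ℂ) • y) = c • F.ip x y := by
  rw [F.ip_smul_right]; simp

theorem isSelfAdjoint_ip_self (x : P) : IsSelfAdjoint (F.ip x x) := (F.ip_conj x x).symm

/-- A linear functional which is `A`-linear for the action underlying the form. -/
def IsALinear (L : P →ₗ[ℂ] A) : Prop := ∀ a p, L (F.act a p) = a * L p

/-- A `A`-linear functional dominated by the form. -/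
def IsContraction (L : P →ₗ[ℂ] A) [PartialOrder A] : Prop :=
  ∀ p, L p * star (L p) ≤ F.ip p p

end Basic

section Order
variable {A : Type*} [NonUnitalCStarAlgebra A] [PartialOrder A] [StarOrderedRing A]
  {P : Type*} [AddCommGroup P] [Module ℂ P] (F : HermForm A P)

theorem cauchy_schwarz_le (hF : ∀ p, 0 ≤ F.ip p p) (x y : P) :
    F.ip y x * F.ip x y ≤ ‖F.ip x x‖ • F.ip y y := by
  set h := F.ip x x with hh
  have key : ∀ ε : ℝ, 0 < ε → F.ip y x * F.ip x y ≤ (‖h‖ + ε) • F.ip y y := by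
    intro ε hε
    have hpos : 0 < ‖h‖ + ε := by positivity
    set t : ℝ := 1 / (‖h‖ + ε) with ht
    have htpos : 0 < t := by positivity
    set a := F.ip y x with ha
    have hxy : F.ip x y = star a := F.ip_conj x y
    have h1 := hF (y - (t : ℂ) • F.act a x)
    have e1 : F.ip (y - (t : ℂ) • F.act a x) (y - (t : ℂ) • F.act a x) =
        F.ip y y - (2 * t) • (a * star a) + t ^ 2 • (a * h * star a) := by
      simp only [F.ip_sub_left, F.ip_sub_right, F.ip_real_smul_left, F.ip_real_smul_right,
        F.ip_act_left, F.ip_act_right, ← ha, hxy, ← hh]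
      rw [smul_smul, mul_assoc a h]
      module
    rw [e1] at h1
    have h2 : a * h * star a ≤ ‖h‖ • (a * star a) :=
      CStarAlgebra.star_right_conjugate_le_norm_smul (hb := F.isSelfAdjoint_ip_self x)
    have haa : 0 ≤ a * star a := mul_star_self_nonneg a
    have h3 : t ^ 2 • (a * h * star a) ≤ t ^ 2 • ‖h‖ • (a * star a) :=
      smul_le_smul_of_nonneg_left h2 (sq_nonneg t)
    have h4 : t ^ 2 • ‖h‖ • (a * star a) ≤ t • (a * star a) := by
      rw [smul_smul]
      refine smul_le_smul_of_nonneg_right ?_ haa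
      have : t * ‖h‖ ≤ 1 := by rw [ht]; rw [div_mul_eq_mul_div, div_le_one hpos]; linarith
      nlinarith
    have h5 : t • (a * star a) ≤ F.ip y y := by
      have : 0 ≤ F.ip y y - (2 * t) • (a * star a) + t • (a * star a) :=
        h1.trans (by gcongr; exact h3.trans h4)
      have e : F.ip y y - (2 * t) • (a * star a) + t • (a * star a) =
        F.ip y y - t • (a * star a) := by module
      rw [e] at this
      exact sub_nonneg.1 this
    have h6 := smul_le_smul_of_nonneg_left h5 hpos.le
    rw [smul_smul, ht, mul_one_div_cancel hpos.ne', one_smul] at h6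
    rwa [hxy]
  have lim : Filter.Tendsto (fun ε : ℝ => (‖h‖ + ε) • F.ip y y)
      (nhdsWithin 0 (Set.Ioi 0)) (nhds (‖h‖ • F.ip y y)) := by
    have : Continuous (fun ε : ℝ => (‖h‖ + ε) • F.ip y y) := by fun_prop
    have h0 := this.tendsto 0
    simp only [add_zero] at h0
    exact h0.mono_left nhdsWithin_le_nhds
  refine ge_of_tendsto lim ?_
  filter_upwards [self_mem_nhdsWithin] with ε hε using key ε hε

theorem norm_ip_sq_le (hF : ∀ p, 0 ≤ F.ip p p) (x y : P) :
    ‖F.ip x y‖ ^ 2 ≤ ‖F.ip x x‖ * ‖F.ip y y‖ := by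
  have h := F.cauchy_schwarz_le hF x y
  rw [F.ip_conj y x] at h
  have h2 := CStarAlgebra.norm_le_norm_of_nonneg_of_le (star_mul_self_nonneg _) h
  rwa [CStarRing.norm_star_mul_self, ← sq, norm_smul, norm_norm] at h2

theorem mul_star_le_of_norm_le (hF : ∀ p, 0 ≤ F.ip p p) (L : P →ₗ[ℂ] A) (hL : F.IsALinear L)
    (K : ℝ) (H : ∀ p, ‖L p‖ ^ 2 ≤ K ^ 2 * ‖F.ip p p‖) (p : P) :
    L p * star (L p) ≤ K ^ 2 • F.ip p p := by
  refine mul_star_self_le_smul_of_norm_le _ _ (hF p) K fun l c => ?_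
  have := H (l • p + F.act c p)
  rw [map_add, map_smul, hL] at this
  refine this.trans_eq ?_
  congr 2
  simp only [F.ip_add_left, F.ip_add_right, F.ip_smul_left, F.ip_smul_right, F.ip_act_left,
    F.ip_act_right, smul_smul, mul_assoc]
  abel

end Order
end HermForm

namespace HermForm

section Hilbert
variable (A : Type*) [NonUnitalCStarAlgebra A] (M : Type*) [NormedAddCommGroup M]
  [NormedSpace ℂ M] [SMul A M]
  [HilbertCStarModule A M]

/-- The inner product of a Hilbert module as a hermitian form. -/
def ofHilbert : HermForm A M where
  act := fun a x => a • x
  ip := hInner A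
  act_zero a := by simpa using HilbertCStarModule.smul_add' a (0 : M) 0
  ip_add_left := HilbertCStarModule.inner_add_left
  ip_smul_left := HilbertCStarModule.inner_smulC_left
  ip_act_left := HilbertCStarModule.inner_smulA_left
  ip_conj := HilbertCStarModule.inner_conj

variable {M}

theorem ofHilbert_norm_sq (x : M) : ‖x‖ ^ 2 = ‖(ofHilbert A M).ip x x‖ := by
  rw [HilbertCStarModule.norm_eq (A := A) x, Real.sq_sqrt (norm_nonneg _)]
  rfl

theorem ofHilbert_eq_zero {x : M} (h : (ofHilbert A M).ip x x = 0) : x = 0 :=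
  (HilbertCStarModule.inner_self_eq_zero x).1 h

variable [PartialOrder A] [StarOrderedRing A]

theorem ofHilbert_nonneg (x : M) : 0 ≤ (ofHilbert A M).ip x x := by
  obtain ⟨b, hb⟩ := HilbertCStarModule.inner_self_pos (A := A) x
  change 0 ≤ HilbertCStarModule.inner x x
  rw [hb]
  exact star_mul_self_nonneg b

theorem ofHilbert_norm_le (x y : M) : ‖(ofHilbert A M).ip x y‖ ≤ ‖x‖ * ‖y‖ := by
  have h := (ofHilbert A M).norm_ip_sq_le (ofHilbert_nonneg A) x y
  rw [← ofHilbert_norm_sq, ← ofHilbert_norm_sq, ← mul_pow] at h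
  exact le_of_sq_le_sq h (by positivity)

end Hilbert

section Completion
variable {A : Type*} [NonUnitalCStarAlgebra A] [PartialOrder A] [StarOrderedRing A]

theorem exists_hilbert_of_seminormed {P : Type*} [SeminormedAddCommGroup P] [NormedSpace ℂ P]
    (F : HermForm A P) (hF : ∀ p, 0 ≤ F.ip p p) (hn : ∀ p, ‖p‖ ^ 2 = ‖F.ip p p‖) :
    ∃ (_ : SMul A (UniformSpace.Completion P))
      (_ : HilbertCStarModule A (UniformSpace.Completion P))
      (j : P →ₗ[ℂ] UniformSpace.Completion P),
      (∀ p q, hInner A (j p) (j q) = F.ip p q) ∧ ∀ a p, j (F.act a p) = a • j p := by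
  have hcs : ∀ x y, ‖F.ip x y‖ ≤ 1 * ‖x‖ * ‖y‖ := fun x y => by
    have h := F.norm_ip_sq_le hF x y
    rw [← hn, ← hn, ← mul_pow] at h
    rw [one_mul]
    exact le_of_sq_le_sq h (by positivity)
  let B : P →ₗ[ℝ] P →ₗ[ℝ] A :=
    LinearMap.mk₂ ℝ F.ip F.ip_add_left F.ip_real_smul_left
      F.ip_add_right F.ip_real_smul_right
  have hBc : Continuous fun p : P × P => F.ip p.1 p.2 := by
    have hB : ∀ x y, ‖B x y‖ ≤ 1 * ‖x‖ * ‖y‖ := hcs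
    exact (LinearMap.mkContinuous₂ B 1 hB).continuous₂
  let Bz : P →+ P →+ A :=
    { toFun := fun x => (B x).toAddMonoidHom
      map_zero' := by ext y; exact F.ip_zero_left y
      map_add' := fun x y => by ext z; exact F.ip_add_left x y z }
  let I : UniformSpace.Completion P × UniformSpace.Completion P → A :=
    ((UniformSpace.Completion.isDenseInducing_coe (α := P)).prodMap
      UniformSpace.Completion.isDenseInducing_coe).extend fun p : P × P => F.ip p.1 p.2
  have hIc : Continuous I :=
    (UniformSpace.Completion.isDenseInducing_toCompl P).extend_Z_bilin
      (UniformSpace.Completion.isDenseInducing_toCompl P) (φ := Bz) hBc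
  have hIe : ∀ x y : P, I ((x : UniformSpace.Completion P), (y : UniformSpace.Completion P)) =
      F.ip x y := fun x y =>
    ((UniformSpace.Completion.isDenseInducing_coe (α := P)).prodMap
      UniformSpace.Completion.isDenseInducing_coe).extend_eq hBc (x, y)
  have hact : ∀ (a : A) (x y : P), ‖F.act a x - F.act a y‖ ≤ ‖a‖ * ‖x - y‖ := fun a x y => by
    have e : F.ip (F.act a x - F.act a y) (F.act a x - F.act a y) =
        a * F.ip (x - y) (x - y) * star a := by
      simp only [F.ip_sub_left, F.ip_sub_right, F.ip_act_left, F.ip_act_right]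
      noncomm_ring
    refine le_of_sq_le_sq ?_ (by positivity)
    rw [hn, e, mul_pow, hn]
    calc _ ≤ ‖a‖ * ‖F.ip (x - y) (x - y)‖ * ‖star a‖ := norm_mul₃_le
      _ = _ := by rw [norm_star]; ring
  have hactu : ∀ a, UniformContinuous (F.act a) := fun a =>
    (LipschitzWith.of_dist_le_mul (K := ‖a‖₊) (f := F.act a) (fun x y => by
      rw [dist_eq_norm, dist_eq_norm]; exact hact a x y)).uniformContinuous
  let sm : SMul A (UniformSpace.Completion P) := ⟨fun a => UniformSpace.Completion.map (F.act a)⟩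
  have hsc : ∀ a : A, Continuous fun x : UniformSpace.Completion P => a • x := fun a =>
    UniformSpace.Completion.continuous_map
  have hse : ∀ (a : A) (x : P), a • (x : UniformSpace.Completion P) =
      ((F.act a x : P) : UniformSpace.Completion P) := fun a x =>
    UniformSpace.Completion.map_coe (hactu a) x
  have hIadd : ∀ x y z, I (x + y, z) = I (x, z) + I (y, z) := fun x y z =>
    UniformSpace.Completion.induction_on₃ x y z (isClosed_eq (by fun_prop) (by fun_prop))
      fun a b c => by rw [← UniformSpace.Completion.coe_add, hIe, hIe, hIe, F.ip_add_left]
  have hIsm : ∀ (c : ℂ) x y, I (c • x, y) = c • I (x, y) := fun c x y =>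
    UniformSpace.Completion.induction_on₂ x y
      (isClosed_eq (hIc.comp ((continuous_fst.const_smul c).prodMk continuous_snd))
        (hIc.const_smul c))
      fun a b => by rw [← UniformSpace.Completion.coe_smul, hIe, hIe, F.ip_smul_left]
  have hIact : ∀ (a : A) x y, I (a • x, y) = a * I (x, y) := fun c x y =>
    UniformSpace.Completion.induction_on₂ x y
      (isClosed_eq (hIc.comp (((hsc c).comp continuous_fst).prodMk continuous_snd))
        (hIc.const_mul c))
      fun a b => by rw [hse, hIe, hIe, F.ip_act_left]
  have hIconj : ∀ x y, I (x, y) = star (I (y, x)) := fun x y =>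
    UniformSpace.Completion.induction_on₂ x y
      (isClosed_eq hIc ((hIc.comp (continuous_snd.prodMk continuous_fst)).star))
      fun a b => by rw [hIe, hIe, F.ip_conj]
  have hIn : ∀ x, ‖x‖ ^ 2 = ‖I (x, x)‖ := fun x =>
    UniformSpace.Completion.induction_on x
      (isClosed_eq (by fun_prop) (hIc.comp (continuous_id.prodMk continuous_id)).norm)
      fun a => by rw [UniformSpace.Completion.norm_coe, hIe, hn]
  have hIpos : ∀ x, 0 ≤ I (x, x) := fun x =>
    UniformSpace.Completion.induction_on x
      (isClosed_le continuous_const (hIc.comp (continuous_id.prodMk continuous_id)))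
      fun a => by rw [hIe]; exact hF a
  have hI0 : ∀ x, I (x, x) = 0 → x = 0 := fun x hx => by
    have := hIn x
    rw [hx, norm_zero] at this
    exact norm_eq_zero.1 (pow_eq_zero_iff (two_ne_zero)|>.1 this)
  have ext : ∀ x y, (∀ z, I (x, z) = I (y, z)) → x = y := fun x y h => by
    have hsub : I (x - y, x - y) = 0 := by
      have h1 := hIadd (x - y) y (x - y)
      rw [sub_add_cancel, h] at h1
      exact (right_eq_add.1 h1)
    exact sub_eq_zero.1 (hI0 _ hsub)
  let hm : HilbertCStarModule A (UniformSpace.Completion P) :=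
    { inner := fun x y => I (x, y)
      smul_add' := fun a x y => ext _ _ fun z => by
        simp only [hIact, hIadd, mul_add]
      add_smul' := fun a b x => ext _ _ fun z => by
        simp only [hIact, hIadd, add_mul]
      mul_smul' := fun a b x => ext _ _ fun z => by
        simp only [hIact, mul_assoc]
      smul_smul' := fun c a x => ext _ _ fun z => by
        simp only [hIact, hIsm, smul_mul_assoc]
      inner_add_left := hIadd
      inner_smulA_left := hIact
      inner_smulC_left := hIsm
      inner_conj := hIconj
      inner_self_pos := fun x => CStarAlgebra.nonneg_iff_eq_star_mul_self.1 (hIpos x)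
      inner_self_eq_zero := fun x => ⟨hI0 x, fun h => by
        rw [h]; simpa using hIsm 0 0 0⟩
      norm_eq := fun x => by rw [← hIn, Real.sqrt_sq (norm_nonneg x)]
      complete := inferInstance }
  exact ⟨sm, hm, (UniformSpace.Completion.toComplₗᵢ (𝕜 := ℂ) (E := P)).toLinearMap, hIe,
    fun a p => (hse a p).symm⟩

theorem exists_hilbert {P : Type v} [AddCommGroup P] [Module ℂ P]
    (F : HermForm A P) (hF : ∀ p, 0 ≤ F.ip p p) :
    ∃ (E : Type v) (_ : NormedAddCommGroup E) (_ : NormedSpace ℂ E) (_ : SMul A E)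
      (_ : HilbertCStarModule A E) (j : P →ₗ[ℂ] E),
      (∀ p q, hInner A (j p) (j q) = F.ip p q) ∧ ∀ a p, j (F.act a p) = a • j p := by
  let nrm : Norm P := ⟨fun p => √‖F.ip p p‖⟩
  have hn : ∀ p : P, ‖p‖ ^ 2 = ‖F.ip p p‖ := fun p => Real.sq_sqrt (norm_nonneg _)
  have core : SeminormedSpace.Core ℂ P :=
    { norm_nonneg := fun x => Real.sqrt_nonneg _
      norm_smul := fun c x => by
        refine (sq_eq_sq₀ (Real.sqrt_nonneg _)
          (mul_nonneg (norm_nonneg c) (Real.sqrt_nonneg _))).1 ?_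
        change ‖c • x‖ ^ 2 = (‖c‖ * ‖x‖) ^ 2
        rw [mul_pow, hn, hn, F.ip_smul_left, F.ip_smul_right, norm_smul, norm_smul, norm_star]
        ring
      norm_triangle := fun x y => by
        refine le_of_sq_le_sq ?_ (add_nonneg (Real.sqrt_nonneg _) (Real.sqrt_nonneg _))
        have hx : 0 ≤ ‖x‖ := Real.sqrt_nonneg _
        have hy : 0 ≤ ‖y‖ := Real.sqrt_nonneg _
        have hcs : ∀ x y, 0 ≤ ‖x‖ → 0 ≤ ‖y‖ → ‖F.ip x y‖ ≤ ‖x‖ * ‖y‖ := fun x y hx hy => by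
          have h := F.norm_ip_sq_le hF x y
          rw [← hn, ← hn, ← mul_pow] at h
          exact le_of_sq_le_sq h (by positivity)
        rw [hn, F.ip_add_left, F.ip_add_right, F.ip_add_right]
        have h1 := norm_add_le (F.ip x x + F.ip x y) (F.ip y x + F.ip y y)
        have h2 := norm_add_le (F.ip x x) (F.ip x y)
        have h3 := norm_add_le (F.ip y x) (F.ip y y)
        have h4 := hcs x y hx hy
        have h5 := hcs y x hy hx
        have h6 := hn x
        have h7 := hn y
        nlinarith }
  let _ : SeminormedAddCommGroup P := SeminormedAddCommGroup.ofCore core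
  let _ : NormedSpace ℂ P := { norm_smul_le := fun c x => (core.norm_smul c x).le }
  obtain ⟨sm, hm, j, h1, h2⟩ := exists_hilbert_of_seminormed F hF hn
  exact ⟨UniformSpace.Completion P, inferInstance, inferInstance, sm, hm, j, h1, h2⟩

end Completion
end HermForm

section DualNorm
variable {A : Type*} [NonUnitalCStarAlgebra A] {M : Type*}
  [NormedAddCommGroup M]

theorem dualNormOn_nonneg (S : Set M) (r : M → A) : 0 ≤ dualNormOn A S r :=
  Real.sInf_nonneg fun _ h => h.1

theorem dualNormOn_le {S : Set M} {r : M → A} {c : ℝ} (hc : 0 ≤ c)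
    (h : ∀ x ∈ S, ‖r x‖ ≤ c * ‖x‖) : dualNormOn A S r ≤ c :=
  csInf_le ⟨0, fun _ h => h.1⟩ ⟨hc, h⟩

theorem dualNorm_eq_dualNormOn_univ (r : M → A) : dualNorm A r = dualNormOn A Set.univ r := by
  simp [dualNorm, dualNormOn]

variable [NormedSpace ℂ M] [SMul A M]

theorem norm_le_dualNormOn {S : Set M} {r : M → A} (hr : IsDualVectorOn A S r) {x : M}
    (hx : x ∈ S) : ‖r x‖ ≤ dualNormOn A S r * ‖x‖ := by
  obtain ⟨C, hC⟩ := hr.bound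
  have hne : {c : ℝ | 0 ≤ c ∧ ∀ x ∈ S, ‖r x‖ ≤ c * ‖x‖}.Nonempty :=
    ⟨|C|, abs_nonneg C, fun y hy => (hC y hy).trans (by gcongr; exact le_abs_self C)⟩
  rcases (norm_nonneg x).eq_or_lt with h0 | hpos
  · have := hC x hx
    rw [← h0] at this ⊢
    simpa using this
  · rw [← div_le_iff₀ hpos]
    exact le_csInf hne fun c hc => (div_le_iff₀ hpos).2 (hc.2 x hx)

theorem IsDualVector.isDualVectorOn {r : M → A} (hr : IsDualVector A r) (S : Set M) :
    IsDualVectorOn A S r where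
  map_add x _ y _ := hr.map_add x y
  map_smulC c x _ := hr.map_smulC c x
  map_smulA a x _ := hr.map_smulA a x
  bound := hr.bound.imp fun _ h x _ => h x

theorem norm_le_dualNorm {r : M → A} (hr : IsDualVector A r) (x : M) :
    ‖r x‖ ≤ dualNorm A r * ‖x‖ := by
  rw [dualNorm_eq_dualNormOn_univ]
  exact norm_le_dualNormOn (hr.isDualVectorOn _) (Set.mem_univ x)

end DualNorm

theorem HilbertCStarModule.norm_smul_sub_smul_le {A : Type*} [NonUnitalCStarAlgebra A] {M : Type*}
    [NormedAddCommGroup M] [NormedSpace ℂ M] [SMul A M] [HilbertCStarModule A M]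
    (a : A) (x y : M) : ‖a • x - a • y‖ ≤ ‖a‖ * ‖x - y‖ := by
  have e : (HermForm.ofHilbert A M).ip (a • x - a • y) (a • x - a • y) =
      a * (HermForm.ofHilbert A M).ip (x - y) (x - y) * star a := by
    have hl := (HermForm.ofHilbert A M).ip_act_left a
    have hr := (HermForm.ofHilbert A M).ip_act_right a
    have e0 : ∀ x : M, (HermForm.ofHilbert A M).act a x = a • x := fun _ => rfl
    simp only [e0] at hl hr
    simp only [HermForm.ip_sub_left, HermForm.ip_sub_right, hl, hr]
    noncomm_ring
  refine le_of_sq_le_sq ?_ (by positivity)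
  rw [HermForm.ofHilbert_norm_sq A (a • x - a • y), e, mul_pow,
    HermForm.ofHilbert_norm_sq A (x - y)]
  calc _ ≤ ‖a‖ * ‖(HermForm.ofHilbert A M).ip (x - y) (x - y)‖ * ‖star a‖ := norm_mul₃_le
    _ = _ := by rw [norm_star]; ring

theorem HilbertCStarModule.continuous_const_smul {A : Type*} [NonUnitalCStarAlgebra A] {M : Type*}
    [NormedAddCommGroup M] [NormedSpace ℂ M] [SMul A M] [HilbertCStarModule A M] (a : A) :
    Continuous fun x : M => a • x :=
  (LipschitzWith.of_dist_le_mul (K := ‖a‖₊) (fun x y => by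
      rw [dist_eq_norm, dist_eq_norm]; exact norm_smul_sub_smul_le a x y)).continuous

namespace HermForm
variable {A : Type u} [NonUnitalCStarAlgebra A] [PartialOrder A] [StarOrderedRing A]

theorem exists_extension (hA : ExtensionProperty.{u, v} A) {P : Type v} [AddCommGroup P]
    [Module ℂ P] (F : HermForm A P) (hF : ∀ p, 0 ≤ F.ip p p) {Z : Type*} [AddCommGroup Z]
    [Module ℂ Z] (FZ : HermForm A Z) (ι : Z →ₗ[ℂ] P)
    (hι : ∀ a z, ι (FZ.act a z) = F.act a (ι z)) (R : Z →ₗ[ℂ] A) (hRa : FZ.IsALinear R)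
    (hR : ∀ z, R z * star (R z) ≤ F.ip (ι z) (ι z)) :
    ∃ R' : P →ₗ[ℂ] A, F.IsALinear R' ∧ F.IsContraction R' ∧ ∀ z, R' (ι z) = R z := by
  obtain ⟨E, i1, i2, i3, i4, j, hj, hja⟩ := F.exists_hilbert hF
  have hjn : ∀ p, ‖j p‖ ^ 2 = ‖F.ip p p‖ := fun p => by
    rw [ofHilbert_norm_sq A, ← hj]; rfl
  let g : Z →ₗ[ℂ] E := j ∘ₗ ι
  have hga : ∀ a z, g (FZ.act a z) = a • g z := fun a z => by
    simp only [g, LinearMap.comp_apply, hι, hja]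
  let N : Submodule ℂ E := (LinearMap.range g).topologicalClosure
  have hgN : ∀ z, g z ∈ N := fun z =>
    (LinearMap.range g).le_topologicalClosure (LinearMap.mem_range_self g z)
  let e : Z →ₗ[ℂ] N := g.codRestrict N hgN
  have hed : DenseRange e := by
    intro x
    rw [closure_subtype]
    have hx := x.2
    have : (Subtype.val '' Set.range e : Set E) = LinearMap.range g := by
      ext y; simp [e]
    rw [this]
    exact hx
  have hnorm : ∀ z, ‖R z‖ ≤ 1 * ‖e z‖ := fun z => by
    rw [one_mul]
    refine le_of_sq_le_sq ?_ (norm_nonneg _)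
    have h1 := CStarAlgebra.norm_le_norm_of_nonneg_of_le (mul_star_self_nonneg _) (hR z)
    rw [CStarRing.norm_self_mul_star, ← sq, ← hjn] at h1
    exact h1
  let rh : N →L[ℂ] A := R.extendOfNorm e
  have hrh : ∀ z, rh (e z) = R z := LinearMap.extendOfNorm_eq hed ⟨1, hnorm⟩
  have hrhn : ∀ x, ‖rh x‖ ≤ 1 * ‖x‖ := fun x =>
    hed.induction_on x (isClosed_le (by fun_prop) (by fun_prop)) fun z => by
      rw [hrh]; exact hnorm z
  have hNa : ∀ (a : A) (x : E), x ∈ N → a • x ∈ N := fun a x hx => by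
    refine map_mem_closure (HilbertCStarModule.continuous_const_smul a) hx ?_
    rintro _ ⟨z, rfl⟩
    exact ⟨FZ.act a z, hga a z⟩
  have hrha : ∀ (a : A) (x : N), rh ⟨a • x.1, hNa a x.1 x.2⟩ = a * rh x := fun a x =>
    hed.induction_on x (isClosed_eq
      (rh.continuous.comp (((HilbertCStarModule.continuous_const_smul a).comp
        continuous_subtype_val).subtype_mk _)) (by fun_prop)) fun z => by
      rw [hrh, ← hRa, ← hrh]
      congr 1
      exact Subtype.ext (hga a z).symm
  classical
  let r : E → A := fun x => if h : x ∈ N then rh ⟨x, h⟩ else 0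
  have hrN : ∀ (x : E) (h : x ∈ N), r x = rh ⟨x, h⟩ := fun x h => dif_pos h
  have hrd : IsDualVectorOn A (N : Set E) r :=
    { map_add := fun x hx y hy => by
        rw [hrN x hx, hrN y hy, hrN _ (N.add_mem hx hy), ← map_add]; rfl
      map_smulC := fun c x hx => by
        rw [hrN x hx, hrN _ (N.smul_mem c hx), ← map_smul]; rfl
      map_smulA := fun a x hx => by
        rw [hrN x hx, hrN _ (hNa a x hx), hrha a ⟨x, hx⟩]
      bound := ⟨1, fun x hx => by rw [hrN x hx]; exact hrhn _⟩ }
  have hNsub : IsHilbertSubmodule A (N : Set E) :=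
    { isClosed := (LinearMap.range g).isClosed_topologicalClosure
      zero_mem := N.zero_mem
      add_mem := fun x y hx hy => N.add_mem hx hy
      smulC_mem := fun c x hx => N.smul_mem c hx
      smulA_mem := fun a x hx => hNa a x hx }
  obtain ⟨r', hr', hr'n, hr'N, -⟩ := hA E (N : Set E) hNsub r hrd
  have hr'1 : dualNorm A r' ≤ 1 := by
    rw [hr'n]
    exact dualNormOn_le zero_le_one fun x hx => by rw [hrN x hx]; exact hrhn _
  let R' : P →ₗ[ℂ] A :=
    { toFun := fun p => r' (j p)
      map_add' := fun p q => by rw [map_add, hr'.map_add]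
      map_smul' := fun c p => by rw [map_smul, hr'.map_smulC]; rfl }
  have hR'a : F.IsALinear R' := fun a p => by
    change r' (j _) = a * r' (j p)
    rw [hja, hr'.map_smulA]
  refine ⟨R', hR'a, fun p => ?_, fun z => ?_⟩
  · have := F.mul_star_le_of_norm_le hF R' hR'a 1 (fun p => ?_) p
    · simpa using this
    · rw [one_pow, one_mul, ← hjn]
      gcongr
      refine (norm_le_dualNorm hr' (j p)).trans ?_
      exact mul_le_of_le_one_left (norm_nonneg _) hr'1
  · change r' (g z) = R z
    rw [hr'N _ (hgN z), hrN _ (hgN z), ← hrh]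
    rfl

end HermForm

namespace HermForm
section Forms
variable {A : Type*} [NonUnitalCStarAlgebra A] {Z X : Type*} [AddCommGroup Z] [Module ℂ Z]
  [AddCommGroup X] [Module ℂ X]

/-- Adding a rank-one term `L₁ L₂* + L₂ L₁*` to a hermitian form. -/
def addCross (F : HermForm A X) (L₁ L₂ : X →ₗ[ℂ] A) (h₁ : F.IsALinear L₁) (h₂ : F.IsALinear L₂) :
    HermForm A X where
  act := F.act
  act_zero := F.act_zero
  ip x y := F.ip x y + (L₁ x * star (L₂ y) + L₂ x * star (L₁ y))
  ip_add_left x y z := by rw [F.ip_add_left, map_add, map_add]; noncomm_ring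
  ip_smul_left c x y := by
    rw [F.ip_smul_left, map_smul, map_smul, smul_mul_assoc, smul_mul_assoc, smul_add, smul_add]
  ip_act_left a x y := by rw [F.ip_act_left, h₁, h₂]; noncomm_ring
  ip_conj x y := by
    rw [F.ip_conj x y]; simp only [star_add, star_mul, star_star]; abel

/-- The orthogonal direct sum of two hermitian forms. -/
def prod (F : HermForm A Z) (G : HermForm A X) : HermForm A (Z × X) where
  act a p := (F.act a p.1, G.act a p.2)
  act_zero a := Prod.ext (F.act_zero a) (G.act_zero a)
  ip p q := F.ip p.1 q.1 + G.ip p.2 q.2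
  ip_add_left x y z := by
    rw [Prod.fst_add, Prod.snd_add, F.ip_add_left, G.ip_add_left]; abel
  ip_smul_left c x y := by
    rw [Prod.smul_fst, Prod.smul_snd, F.ip_smul_left, G.ip_smul_left, smul_add]
  ip_act_left a x y := by rw [F.ip_act_left, G.ip_act_left, mul_add]
  ip_conj x y := by rw [F.ip_conj, G.ip_conj, star_add]

/-- The restriction of a hermitian form to an invariant subspace. -/
def restrict (F : HermForm A Z) (S : Submodule ℂ Z) (hS : ∀ a, ∀ z ∈ S, F.act a z ∈ S) :
    HermForm A S where
  act a z := ⟨F.act a z, hS a z z.2⟩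
  act_zero a := Subtype.ext (F.act_zero a)
  ip x y := F.ip x y
  ip_add_left x y z := F.ip_add_left x y z
  ip_smul_left c x y := F.ip_smul_left c x y
  ip_act_left a x y := F.ip_act_left a x y
  ip_conj x y := F.ip_conj x y

/-- The form `F(z, z) + R(z) β(x)* + β(x) R(z)* + β(x) β(x)* + G(x, x)` on `Z × X`. -/
def couple (F : HermForm A Z) (R : Z →ₗ[ℂ] A) (hR : F.IsALinear R) (G : HermForm A X)
    (β : X →ₗ[ℂ] A) (hβ : G.IsALinear β) : HermForm A (Z × X) :=
  (F.prod G).addCross (R ∘ₗ LinearMap.fst ℂ Z X + (1 / 2 : ℂ) • (β ∘ₗ LinearMap.snd ℂ Z X))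
    (β ∘ₗ LinearMap.snd ℂ Z X)
    (fun a p => by
      simp only [LinearMap.add_apply, LinearMap.smul_apply, LinearMap.comp_apply]
      change R (F.act a p.1) + (1 / 2 : ℂ) • β (G.act a p.2) = _
      rw [hR, hβ, mul_add, mul_smul_comm]; rfl)
    (fun a p => hβ a p.2)

theorem couple_ip_self (F : HermForm A Z) (R : Z →ₗ[ℂ] A) (hR : F.IsALinear R) (G : HermForm A X)
    (β : X →ₗ[ℂ] A) (hβ : G.IsALinear β) (z : Z) (x : X) :
    (F.couple R hR G β hβ).ip (z, x) (z, x) = F.ip z z + R z * star (β x) + β x * star (R z) +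
      β x * star (β x) + G.ip x x := by
  change F.ip z z + G.ip x x + ((R z + (1 / 2 : ℂ) • β x) * star (β x) +
    β x * star (R z + (1 / 2 : ℂ) • β x)) = _
  have h : star (1 / 2 : ℂ) = 1 / 2 := by simp
  rw [star_add, star_smul, h, add_mul, mul_add, smul_mul_assoc, mul_smul_comm]
  module

end Forms

section Elimination
variable {A : Type u} [NonUnitalCStarAlgebra A] [PartialOrder A] [StarOrderedRing A]

theorem nonneg_of_couple_nonneg (hA : ExtensionProperty.{u, v} A) {Z X : Type v}
    [AddCommGroup Z] [Module ℂ Z] [AddCommGroup X] [Module ℂ X] {M : Type*} [AddCommGroup M]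
    [Module ℂ M] (H : HermForm A M) (hH : ∀ m, 0 ≤ H.ip m m)
    (F : HermForm A Z) (R : Z →ₗ[ℂ] A) (hR : F.IsALinear R) (hRF : F.IsContraction R)
    (thin : ∀ y : M, (∀ z m, (R z + H.ip m y) * star (R z + H.ip m y) ≤ F.ip z z + H.ip m m) →
      ∀ m, H.ip m y = 0)
    (G : HermForm A X) (β : X →ₗ[ℂ] A) (hβ : G.IsALinear β)
    (faithful : ∀ g : A, (∀ m m', g * H.ip m m' = 0) → ∀ x, G.act g x = 0)
    (hpos : ∀ z x, 0 ≤ (F.couple R hR G β hβ).ip (z, x) (z, x)) (x : X) :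
    0 ≤ G.ip x x := by
  set W := F.couple R hR G β hβ with hW
  have hip : ∀ z x, W.ip (z, x) (z, x) = F.ip z z + R z * star (β x) + β x * star (R z) +
      β x * star (β x) + G.ip x x := couple_ip_self F R hR G β hβ
  have hact : ∀ a z x, W.act a (z, x) = (F.act a z, G.act a x) := fun _ _ _ => rfl
  obtain ⟨R', hR'a, hR'c, hR'R⟩ := exists_extension hA W (fun p => hpos p.1 p.2) F
    (LinearMap.inl ℂ Z X) (fun a z => by
      rw [LinearMap.inl_apply, LinearMap.inl_apply, hact, G.act_zero]) R hR (fun z => by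
      rw [LinearMap.inl_apply, hip]
      simpa [G.ip_zero_left] using hRF z)
  set p : X →ₗ[ℂ] A := R' ∘ₗ LinearMap.inr ℂ Z X with hp
  have hpa : G.IsALinear p := fun a x => by
    rw [hp, LinearMap.comp_apply, LinearMap.comp_apply, ← hR'a, LinearMap.inr_apply,
      LinearMap.inr_apply, hact, F.act_zero]
  have hsum : ∀ z x, R' (z, x) = R z + p x := fun z x => by
    rw [← hR'R, hp, LinearMap.comp_apply, ← map_add]
    simp
  have horth : ∀ x m m0, H.ip m m0 * (p x - β x) = 0 := by
    intro x m1 m0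
    set S : A := β x * star (β x) + G.ip x x - β x * star (p x) - p x * star (β x) +
      β x * star (β x) with hS
    have hSsa : IsSelfAdjoint S := by
      rw [hS, IsSelfAdjoint]
      simp only [star_add, star_sub, star_mul, star_star, ← G.ip_conj x x]
      abel
    set t : ℝ := ‖S‖ * ‖H.ip m0 m0‖ with ht
    have ht0 : 0 ≤ t := by positivity
    set κ : ℝ := 1 / (t + 1) with hκ
    have hκ0 : 0 < κ := by positivity
    have hκ1 : κ ^ 2 * t ≤ 1 := by
      rw [hκ, div_pow, one_pow, div_mul_eq_mul_div, one_mul, div_le_one (by positivity)]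
      nlinarith
    have := thin ((κ : ℂ) • H.act (star (p x - β x)) m0) (fun z m => ?_) m1
    · rw [H.ip_real_smul_right, H.ip_act_right, star_star] at this
      exact (smul_eq_zero.1 this).resolve_left hκ0.ne'
    rw [H.ip_real_smul_right, H.ip_act_right, star_star]
    set a := H.ip m m0 with ha
    have haa : a * star a ≤ ‖H.ip m0 m0‖ • H.ip m m := by
      have := H.cauchy_schwarz_le hH m0 m
      rwa [H.ip_conj m0 m] at this
    have h1 := hR'c (z, (κ : ℂ) • G.act a x)
    rw [hsum, hip, map_smul, map_smul, G.ip_real_smul_left, G.ip_real_smul_right, G.ip_act_left,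
      G.ip_act_right, hpa, hβ, Complex.coe_smul, Complex.coe_smul] at h1
    have h2 : a * S * star a ≤ ‖S‖ • (a * star a) :=
      CStarAlgebra.star_right_conjugate_le_norm_smul (hb := hSsa)
    have h3 : κ ^ 2 • (a * S * star a) ≤ H.ip m m := by
      calc κ ^ 2 • (a * S * star a) ≤ κ ^ 2 • ‖S‖ • ‖H.ip m0 m0‖ • H.ip m m := by
            refine smul_le_smul_of_nonneg_left (h2.trans ?_) (sq_nonneg κ)
            exact smul_le_smul_of_nonneg_left haa (norm_nonneg S)
        _ = (κ ^ 2 * t) • H.ip m m := by rw [smul_smul, smul_smul, ht, mul_assoc]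
        _ ≤ (1 : ℝ) • H.ip m m := smul_le_smul_of_nonneg_right hκ1 (hH m)
        _ = _ := one_smul _ _
    rw [← sub_nonneg] at h1 h3 ⊢
    refine (add_nonneg h1 h3).trans_eq ?_
    rw [hS]
    simp only [mul_add, add_mul, mul_sub, sub_mul, star_add, star_sub, star_mul, star_smul,
      star_trivial, mul_smul_comm, smul_mul_assoc, smul_add, smul_sub, mul_assoc]
    module
  have hpβ : ∀ x, p x = β x := by
    intro x
    have h0 := faithful (star (p x - β x)) (fun m m' => by
      have := congrArg star (horth x m' m)
      rwa [star_mul, star_zero, ← H.ip_conj] at this) x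
    have h1 : star (p x - β x) * (p x - β x) = 0 := by
      rw [mul_sub, ← hpa, ← hβ, h0, map_zero, map_zero, sub_zero]
    exact sub_eq_zero.1 ((CStarRing.star_mul_self_eq_zero_iff _).1 h1)
  have h1 := hR'c (0, x)
  rw [hsum, hip, map_zero, zero_add, hpβ, F.ip_zero_left] at h1
  simpa using h1
end Elimination
end HermForm

namespace HermForm
section Companion
variable {A : Type*} [NonUnitalCStarAlgebra A] {M : Type*} [AddCommGroup M] [Module ℂ M]
  (H : HermForm A M)

/-- The functional `⟨·, y⟩`. -/
def toLin (y : M) : M →ₗ[ℂ] A where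
  toFun x := H.ip x y
  map_add' x z := H.ip_add_left x z y
  map_smul' c x := H.ip_smul_left c x y

theorem toLin_isALinear (y : M) : H.IsALinear (H.toLin y) := fun a x => H.ip_act_left a x y

/-- The orthogonal direct sum of copies of a hermitian form. -/
def finsupp (I : Type*) : HermForm A (I →₀ M) where
  act a t := t.mapRange (H.act a) (H.act_zero a)
  act_zero a := Finsupp.mapRange_zero
  ip s t := s.sum fun i x => H.ip x (t i)
  ip_add_left x y z :=
    Finsupp.sum_add_index' (fun _ => H.ip_zero_left _) fun _ _ _ => H.ip_add_left _ _ _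
  ip_smul_left c x y := by
    rw [Finsupp.sum_smul_index' (h := fun i x => H.ip x (y i)) fun _ => H.ip_zero_left _,
      Finsupp.smul_sum]
    simp only [H.ip_smul_left]
  ip_act_left a x y := by
    rw [Finsupp.sum_mapRange_index (h := fun i x => H.ip x (y i)) fun _ => H.ip_zero_left _,
      Finsupp.sum, Finsupp.sum, Finset.mul_sum]
    simp only [H.ip_act_left]
  ip_conj x y := by
    classical
    rw [Finsupp.sum_of_support_subset x (Finset.subset_union_left (s₂ := y.support))
        (fun i x => H.ip x (y i)) fun _ _ => H.ip_zero_left _,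
      Finsupp.sum_of_support_subset y (Finset.subset_union_right (s₁ := x.support))
        (fun i y => H.ip y (x i)) fun _ _ => H.ip_zero_left _, star_sum]
    exact Finset.sum_congr rfl fun i _ => H.ip_conj _ _

theorem finsupp_ip_single_left {I : Type*} (i : I) (x : M) (t : I →₀ M) :
    (H.finsupp I).ip (Finsupp.single i x) t = H.ip x (t i) :=
  Finsupp.sum_single_index (h := fun i x => H.ip x (t i)) (H.ip_zero_left _)

theorem finsupp_ip_add_single {I : Type*} (i : I) (x : M) (t : I →₀ M) (ht : t i = 0) :
    (H.finsupp I).ip (t + Finsupp.single i x) (t + Finsupp.single i x) =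
      (H.finsupp I).ip t t + H.ip x x := by
  rw [ip_add_left, ip_add_right, (H.finsupp I).ip_conj t (Finsupp.single i x)]
  simp [finsupp_ip_single_left, ht, H.ip_zero_right]

/-- The functional `t ↦ ∑ ⟨t (y, j), y⟩` on finitely supported families indexed by `M × ℕ`. -/
def companion : ((M × ℕ) →₀ M) →ₗ[ℂ] A := Finsupp.lsum ℂ fun i : M × ℕ => H.toLin i.1

theorem companion_single (i : M × ℕ) (x : M) : H.companion (Finsupp.single i x) = H.ip x i.1 := by
  rw [companion, Finsupp.lsum_single]; rfl

theorem companion_isALinear : (H.finsupp (M × ℕ)).IsALinear H.companion := fun a t => by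
  change (t.mapRange (H.act a) (H.act_zero a)).sum (fun i x => H.ip x i.1) =
    a * t.sum fun i x => H.ip x i.1
  rw [Finsupp.sum_mapRange_index (h := fun (i : M × ℕ) x => H.ip x i.1) fun _ => H.ip_zero_left _,
    Finsupp.sum, Finsupp.sum, Finset.mul_sum]
  simp only [H.ip_act_left]

variable [PartialOrder A]

/-- The functional `r` on `N` together with the companions indexed by `Y` is a contraction. -/
def CompatibleOn (N : Submodule ℂ M) (r : M → A) (Y : Set (M × ℕ)) : Prop :=
  ∀ n ∈ N, ∀ t ∈ Finsupp.supported M ℂ Y,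
    (r n + H.companion t) * star (r n + H.companion t) ≤
      H.ip n n + (H.finsupp (M × ℕ)).ip t t

/-- No further nonzero companion can be adjoined to `r` and `Y`. -/
def SaturatedOn (N : Submodule ℂ M) (r : M → A) (Y : Set (M × ℕ)) : Prop :=
  ∀ y : M, (∀ n ∈ N, ∀ t ∈ Finsupp.supported M ℂ Y, ∀ m,
    (r n + H.companion t + H.ip m y) * star (r n + H.companion t + H.ip m y) ≤
      H.ip n n + (H.finsupp (M × ℕ)).ip t t + H.ip m m) → y = 0

/-- The functional `q` is a contraction together with a family of companions which is
saturated with respect to `N`. -/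
def IsRegular (N : Submodule ℂ M) (q : M → A) : Prop :=
  ∃ Y, H.CompatibleOn ⊤ q Y ∧ H.SaturatedOn N q Y

variable [StarOrderedRing A]

theorem finsupp_nonneg (hH : ∀ m, 0 ≤ H.ip m m) {I : Type*} (t : I →₀ M) :
    0 ≤ (H.finsupp I).ip t t :=
  Finset.sum_nonneg fun _ _ => hH _

theorem prod_nonneg {X Y : Type*} [AddCommGroup X] [Module ℂ X] [AddCommGroup Y] [Module ℂ Y]
    {F : HermForm A X} {G : HermForm A Y} (hF : ∀ x, 0 ≤ F.ip x x) (hG : ∀ x, 0 ≤ G.ip x x)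
    (p : X × Y) : 0 ≤ (F.prod G).ip p p :=
  add_nonneg (hF _) (hG _)

theorem exists_saturated (hdef : ∀ m, H.ip m m = 0 → m = 0)
    (N : Submodule ℂ M) (r : M → A) (hr0 : r 0 = 0)
    (hr : ∀ n ∈ N, r n * star (r n) ≤ H.ip n n) :
    ∃ Y, H.CompatibleOn N r Y ∧ H.SaturatedOn N r Y := by
  obtain ⟨Y, -, hY⟩ := zorn_subset_nonempty {Y | H.CompatibleOn N r Y} (fun c hc hchain hne => by
    refine ⟨⋃₀ c, fun n hn t ht => ?_, fun s hs => Set.subset_sUnion_of_mem hs⟩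
    obtain ⟨s, hs, hts⟩ := DirectedOn.exists_mem_subset_of_finset_subset_biUnion
      (s := t.support) (c := c) (f := id) hne hchain.directedOn
      (fun i hi => by simpa using ht hi)
    exact hc hs n hn t hts) ∅ (fun n hn t ht => by
      have : t = 0 := by simpa using ht
      rw [this, map_zero, add_zero, ip_zero_left, add_zero]
      exact hr n hn)
  refine ⟨Y, hY.prop, fun y hy => ?_⟩
  by_cases h : ∀ j, (y, j) ∈ Y
  · let t : ℕ → (M × ℕ) →₀ M := fun k => ∑ j ∈ Finset.range k, Finsupp.single (y, j) y
    have ht : ∀ k, t k ∈ Finsupp.supported M ℂ Y := fun k =>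
      Submodule.sum_mem _ fun j _ => Finsupp.single_mem_supported ℂ y (h j)
    have htC : ∀ k, H.companion (t k) = (k : ℝ) • H.ip y y := fun k => by
      simp only [t, map_sum, companion_single, Finset.sum_const, Finset.card_range]
      rw [Nat.cast_smul_eq_nsmul]
    have htip : ∀ k, (H.finsupp (M × ℕ)).ip (t k) (t k) = (k : ℝ) • H.ip y y := fun k => by
      induction k with
      | zero => simp [t, ip_zero_left]
      | succ k ih =>
        have e : t (k + 1) = t k + Finsupp.single (y, k) y := Finset.sum_range_succ _ _
        rw [e, finsupp_ip_add_single, ih, Nat.cast_succ, add_smul, one_smul]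
        simp only [t, Finsupp.finsetSum_apply]
        refine Finset.sum_eq_zero fun j hj => Finsupp.single_eq_of_ne ?_
        simp only [ne_eq, Prod.mk.injEq, true_and]
        exact (Finset.mem_range.1 hj).ne'
    have hle : ∀ k : ℕ, (k : ℝ) * ‖H.ip y y‖ ≤ 1 := fun k => by
      have h1 := hY.prop 0 N.zero_mem (t k) (ht k)
      rw [hr0, zero_add, H.ip_zero_left, zero_add, htC, htip] at h1
      have h2 := CStarAlgebra.norm_le_norm_of_nonneg_of_le (mul_star_self_nonneg _) h1
      rw [CStarRing.norm_self_mul_star, norm_smul, Real.norm_natCast] at h2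
      rcases (mul_nonneg (Nat.cast_nonneg (α := ℝ) k)
        (norm_nonneg (H.ip y y))).eq_or_lt with h0 | h0
      · rw [← h0]; exact zero_le_one
      · exact le_of_mul_le_mul_right (by linarith) h0
    refine hdef y (norm_le_zero_iff.1 ?_)
    by_contra hpos
    push Not at hpos
    obtain ⟨k, hk⟩ := exists_nat_gt (1 / ‖H.ip y y‖)
    have := hle k
    rw [div_lt_iff₀ hpos] at hk
    linarith
  · push Not at h
    obtain ⟨j, hj⟩ := h
    exfalso
    refine hj (hY.le_of_ge (y := insert (y, j) Y) (fun n hn t ht => ?_) (Set.subset_insert _ _)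
      (Set.mem_insert _ _))
    have e : t.erase (y, j) + Finsupp.single (y, j) (t (y, j)) = t := Finsupp.erase_add_single _ _
    have hes : t.erase (y, j) ∈ Finsupp.supported M ℂ Y := by
      classical
      intro i hi
      rw [Finset.mem_coe, Finsupp.support_erase, Finset.mem_erase] at hi
      exact (ht hi.2).resolve_left hi.1
    have h1 := hy n hn _ hes (t (y, j))
    rw [← e, finsupp_ip_add_single _ _ _ _ Finsupp.erase_same, map_add, companion_single,
      ← add_assoc, ← add_assoc]
    simpa using h1

end Companion

section Regular
variable {A : Type u} [NonUnitalCStarAlgebra A] [PartialOrder A] [StarOrderedRing A]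
  {M : Type v} [AddCommGroup M] [Module ℂ M] (H : HermForm A M)

theorem exists_regular_extension (hA : ExtensionProperty.{u, v} A)
    (hdef : ∀ m, H.ip m m = 0 → m = 0) (hH : ∀ m, 0 ≤ H.ip m m)
    (N : Submodule ℂ M) (hN : ∀ a, ∀ n ∈ N, H.act a n ∈ N) (r : N →ₗ[ℂ] A)
    (hra : (H.restrict N hN).IsALinear r) (hr : (H.restrict N hN).IsContraction r) :
    ∃ q : M →ₗ[ℂ] A, H.IsALinear q ∧ H.IsRegular N q ∧ ∀ n : N, q n = r n := by
  classical
  let r' : M → A := fun x => if h : x ∈ N then r ⟨x, h⟩ else 0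
  have hr' : ∀ x (h : x ∈ N), r' x = r ⟨x, h⟩ := fun x h => dif_pos h
  obtain ⟨Y, hY, hYs⟩ := H.exists_saturated hdef N r'
    (by rw [hr' 0 N.zero_mem]; exact map_zero r) (fun n hn => by rw [hr' n hn]; exact hr ⟨n, hn⟩)
  let S := Finsupp.supported M ℂ Y
  have hS : ∀ a, ∀ t ∈ S, (H.finsupp (M × ℕ)).act a t ∈ S := fun a t ht i hi =>
    ht (Finsupp.support_mapRange (hf := (H.act_zero a)) hi)
  obtain ⟨R', hR'a, hR'c, hR'⟩ := exists_extension hA (H.prod (H.finsupp (M × ℕ)))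
    (prod_nonneg hH (H.finsupp_nonneg hH)) ((H.restrict N hN).prod ((H.finsupp _).restrict S hS))
    (N.subtype.prodMap S.subtype) (fun a z => rfl) (r.coprod (H.companion ∘ₗ S.subtype))
    (fun a z => by
      rw [LinearMap.coprod_apply, LinearMap.coprod_apply, mul_add]
      exact congrArg₂ (· + ·) (hra a z.1) (H.companion_isALinear a z.2))
    (fun z => by
      have := hY z.1 z.1.2 z.2 z.2.2
      rwa [hr' _ z.1.2] at this)
  have hq : ∀ n : N, (R' ∘ₗ LinearMap.inl ℂ M ((M × ℕ) →₀ M)) n = r n := fun n => by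
    simpa using hR' (n, 0)
  refine ⟨R' ∘ₗ LinearMap.inl ℂ M ((M × ℕ) →₀ M), fun a x => ?_, ⟨Y, fun n _ t ht => ?_, ?_⟩, hq⟩
  · rw [LinearMap.comp_apply, LinearMap.comp_apply, ← hR'a]
    congr 1
    exact Prod.ext rfl ((H.finsupp (M × ℕ)).act_zero a).symm
  · have h1 : R' (0, t) = H.companion t := by simpa using hR' (0, ⟨t, ht⟩)
    have h2 := hR'c (n, t)
    have h3 : R' (n, t) = R' (n, 0) + H.companion t := by
      rw [← h1, ← map_add]; simp
    rw [h3] at h2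
    exact h2
  · intro y hy
    refine hYs y fun n hn t ht m => ?_
    have := hy n hn t ht m
    rwa [hq ⟨n, hn⟩, ← hr' n hn] at this

end Regular
end HermForm

/-- A positive element of a C*-algebra has approximate inverses `u` with `u h u ≤ u` which
commute with it. -/
theorem exists_approx_inverse {A : Type*} [NonUnitalCStarAlgebra A] [PartialOrder A]
    [StarOrderedRing A] {h : A} (hh : 0 ≤ h) {ε : ℝ} (hε : 0 < ε) :
    ∃ u : A, IsSelfAdjoint u ∧ u * h = h * u ∧ u * h * u ≤ u ∧ 0 ≤ u * h * u ∧
      ‖h - h * u * h - h * (u * h) + h * u * h * (u * h)‖ ≤ ε := by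
  have hsa : IsSelfAdjoint h := .of_nonneg hh
  let f : ℝ → ℝ := fun x => x / (x ^ 2 + ε ^ 2)
  have hpos : ∀ x : ℝ, 0 < x ^ 2 + ε ^ 2 := fun x => by positivity
  have hf : Continuous f := continuous_id.div (by fun_prop) fun x => (hpos x).ne'
  have hf0 : f 0 = 0 := by simp [f]
  have hid : cfcₙ (fun x : ℝ => x) h = h := cfcₙ_id' ℝ h
  have huh : cfcₙ f h * h = cfcₙ (fun x => f x * x) h := by
    rw [cfcₙ_mul f (fun x => x) h hf.continuousOn hf0, hid]
  have hhu : h * cfcₙ f h = cfcₙ (fun x => f x * x) h := by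
    rw [← huh]
    simpa only [hid] using (cfcₙ_commute_cfcₙ (fun x : ℝ => x) f h).eq
  have hg : Continuous fun x => f x * x := hf.mul continuous_id
  have hsq : ∀ x ∈ quasispectrum ℝ h, 0 ≤ x := fun x hx => quasispectrum_nonneg_of_nonneg h hh x hx
  have huhu : cfcₙ f h * h * cfcₙ f h = cfcₙ (fun x => f x * x * f x) h := by
    rw [cfcₙ_mul (fun x => f x * x) f h hg.continuousOn (by simp) hf.continuousOn hf0, huh]
  refine ⟨cfcₙ f h, cfcₙ_predicate f h, huh.trans hhu.symm, ?_, ?_, ?_⟩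
  · rw [huhu]
    refine cfcₙ_mono (fun x hx => ?_) (hg.mul hf).continuousOn hf.continuousOn (by simp) hf0
    have h0 := hsq x hx
    have h1 : f x * x ≤ 1 := by
      simp only [f, div_mul_eq_mul_div]
      rw [div_le_one (hpos x)]; nlinarith [sq_nonneg ε]
    have h2 : 0 ≤ f x := div_nonneg h0 (hpos x).le
    simpa using mul_le_mul_of_nonneg_right h1 h2
  · rw [huhu]
    refine cfcₙ_nonneg fun x hx => ?_
    nlinarith [mul_nonneg (hsq x hx) (sq_nonneg (f x))]
  · have e : h - h * cfcₙ f h * h - h * (cfcₙ f h * h) + h * cfcₙ f h * h * (cfcₙ f h * h) =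
        cfcₙ (fun x => x - f x * x * x - x * (f x * x) + f x * x * x * (f x * x)) h := by
      have c1 : Continuous fun x : ℝ => x := continuous_id
      have c2 : Continuous fun x : ℝ => f x * x * x := hg.mul continuous_id
      have c3 : Continuous fun x : ℝ => x * (f x * x) := continuous_id.mul hg
      rw [cfcₙ_add (fun x => x - f x * x * x - x * (f x * x)) (fun x => f x * x * x * (f x * x)) h
          ((c1.sub c2).sub c3).continuousOn (by simp) (c2.mul hg).continuousOn (by simp),
        cfcₙ_sub (fun x => x - f x * x * x) (fun x => x * (f x * x)) h
          (c1.sub c2).continuousOn (by simp) c3.continuousOn (by simp),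
        cfcₙ_sub (fun x => x) (fun x => f x * x * x) h c1.continuousOn (by simp)
          c2.continuousOn (by simp),
        cfcₙ_mul (fun x => f x * x * x) (fun x => f x * x) h c2.continuousOn (by simp)
          hg.continuousOn (by simp),
        cfcₙ_mul (fun x => f x * x) (fun x => x) h hg.continuousOn (by simp)
          c1.continuousOn (by simp),
        cfcₙ_mul (fun x => x) (fun x => f x * x) h c1.continuousOn (by simp)
          hg.continuousOn (by simp), hid, hhu, huh]
    rw [e]
    refine norm_cfcₙ_le fun x hx => ?_
    have h0 := hsq x hx
    have e2 : x - f x * x * x - x * (f x * x) + f x * x * x * (f x * x) =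
        x * (ε ^ 2 / (x ^ 2 + ε ^ 2)) ^ 2 := by
      simp only [f]; field_simp [(hpos x).ne']; ring
    rw [e2, Real.norm_of_nonneg (by positivity), div_pow, mul_div_assoc', div_le_iff₀ (by
      have := hpos x; positivity)]
    have h3 : x * ε ≤ x ^ 2 + ε ^ 2 := by nlinarith [sq_nonneg (x - ε)]
    have h4 : ε ^ 2 ≤ x ^ 2 + ε ^ 2 := by nlinarith
    calc x * (ε ^ 2) ^ 2 = ε * ((x * ε) * ε ^ 2) := by ring
      _ ≤ ε * ((x ^ 2 + ε ^ 2) * (x ^ 2 + ε ^ 2)) := by gcongr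
      _ = _ := by ring

namespace HermForm
variable {A : Type*} [NonUnitalCStarAlgebra A] [PartialOrder A] [StarOrderedRing A]
  {M : Type*} [AddCommGroup M] [Module ℂ M] (H : HermForm A M)

/-- Approximate orthogonal decomposition with respect to a vector. -/
theorem exists_approx_projection (hH : ∀ m, 0 ≤ H.ip m m) (x n : M) {ε : ℝ} (hε : 0 < ε) :
    ∃ a : A, ‖H.ip (x - H.act a n) n‖ ≤ ε ∧
      H.ip (x - H.act a n) (x - H.act a n) ≤ H.ip x x ∧
      H.ip (H.act a n) (H.act a n) ≤ H.ip x x := by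
  obtain ⟨u, hu, hcomm, hle, hpos, hnorm⟩ := exists_approx_inverse (hH n)
    (ε := ε ^ 2 / (‖H.ip x x‖ + 1)) (by positivity)
  set h := H.ip n n with hh
  set p := H.ip x n with hp
  have hnx : H.ip n x = star p := H.ip_conj n x
  have hus : star u = u := hu
  have e1 : H.ip (H.act (p * u) n) (H.act (p * u) n) = p * (u * h * u) * star p := by
    rw [H.ip_act_left, H.ip_act_right, star_mul, hus, ← hh]; noncomm_ring
  have e2 : H.ip (x - H.act (p * u) n) (x - H.act (p * u) n) =
      H.ip x x - (2 : ℝ) • (p * u * star p) + p * (u * h * u) * star p := by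
    rw [← e1]
    simp only [H.ip_sub_left, H.ip_sub_right, H.ip_act_left, H.ip_act_right, star_mul, hus, hnx,
      ← hh, ← hp]
    rw [two_smul, mul_assoc p u (star p)]; abel
  have h1 : p * (u * h * u) * star p ≤ p * u * star p := star_right_conjugate_le_conjugate hle p
  have h2 : 0 ≤ p * (u * h * u) * star p := star_right_conjugate_nonneg hpos p
  refine ⟨p * u, ?_, ?_, ?_⟩
  · have e3 : H.ip (x - H.act (p * u) n) n = H.ip x (n - H.act (h * u) n) := by
      rw [H.ip_sub_left, H.ip_sub_right, H.ip_act_left, H.ip_act_right, star_mul, hus,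
        (H.isSelfAdjoint_ip_self n).star_eq, mul_assoc]
    rw [e3]
    have h3 := H.norm_ip_sq_le hH x (n - H.act (h * u) n)
    have e4 : H.ip (n - H.act (h * u) n) (n - H.act (h * u) n) =
        h - h * u * h - h * (u * h) + h * u * h * (u * h) := by
      have hhs : star h = h := H.isSelfAdjoint_ip_self n
      simp only [H.ip_sub_left, H.ip_sub_right, H.ip_act_left, H.ip_act_right, star_mul, hus,
        ← hh, hhs]
      noncomm_ring
    rw [e4] at h3
    refine le_of_sq_le_sq (h3.trans ?_) hε.le
    calc _ ≤ ‖H.ip x x‖ * (ε ^ 2 / (‖H.ip x x‖ + 1)) := by gcongr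
      _ ≤ (‖H.ip x x‖ + 1) * (ε ^ 2 / (‖H.ip x x‖ + 1)) := by gcongr; linarith
      _ = _ := by field_simp
  · rw [e2, ← sub_nonneg]
    have : 0 ≤ (p * u * star p - p * (u * h * u) * star p) + (p * (u * h * u) * star p +
      (p * u * star p - p * (u * h * u) * star p)) :=
      add_nonneg (sub_nonneg.2 h1) (add_nonneg h2 (sub_nonneg.2 h1))
    refine this.trans_eq ?_
    rw [two_smul]; abel
  · have := hH (x - H.act (p * u) n)
    rw [e2] at this
    rw [e1, ← sub_nonneg]
    refine (add_nonneg this (add_nonneg (sub_nonneg.2 h1) (sub_nonneg.2 h1))).trans_eq ?_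
    rw [two_smul]; abel

end HermForm

theorem nonneg_of_forall_exists_norm_le {A : Type*} [NonUnitalCStarAlgebra A] [PartialOrder A]
    [StarOrderedRing A] {E : A} (h : ∀ ε : ℝ, 0 < ε → ∃ d : A, ‖d‖ ≤ ε ∧ 0 ≤ E + d) : 0 ≤ E := by
  have hcl : IsClosed {a : A | 0 ≤ a} := CStarAlgebra.isClosed_nonneg
  refine hcl.closure_subset_iff.2 subset_rfl (Metric.mem_closure_iff.2 fun ε hε => ?_)
  obtain ⟨d, hd, hE⟩ := h (ε / 2) (by positivity)
  refine ⟨E + d, hE, ?_⟩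
  rw [dist_eq_norm, sub_add_cancel_left, norm_neg]
  linarith

namespace HermForm
section Augmented
variable {A : Type*} [NonUnitalCStarAlgebra A] {M : Type*} [AddCommGroup M] [Module ℂ M]
  (H : HermForm A M)

theorem act_mem_supported (Y : Set (M × ℕ)) (a : A) (t : (M × ℕ) →₀ M)
    (ht : t ∈ Finsupp.supported M ℂ Y) :
    (H.finsupp (M × ℕ)).act a t ∈ Finsupp.supported M ℂ Y := fun _ hi =>
  ht (Finsupp.support_mapRange (hf := H.act_zero a) hi)

/-- The form on the direct sum of `N` and the finitely supported families on `Y`. -/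
def augForm (N : Submodule ℂ M) (hN : ∀ a, ∀ n ∈ N, H.act a n ∈ N) (Y : Set (M × ℕ)) :
    HermForm A (N × Finsupp.supported M ℂ Y) :=
  (H.restrict N hN).prod ((H.finsupp (M × ℕ)).restrict _ (H.act_mem_supported Y))

/-- The functional `(n, t) ↦ q n + ∑ ⟨t (y, j), y⟩`. -/
def augFun (N : Submodule ℂ M) (q : M →ₗ[ℂ] A) (Y : Set (M × ℕ)) :
    (N × Finsupp.supported M ℂ Y) →ₗ[ℂ] A :=
  (q ∘ₗ N.subtype).coprod (H.companion ∘ₗ (Finsupp.supported M ℂ Y).subtype)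

theorem augFun_apply (N : Submodule ℂ M) (q : M →ₗ[ℂ] A) (Y : Set (M × ℕ))
    (z : N × Finsupp.supported M ℂ Y) : H.augFun N q Y z = q z.1 + H.companion z.2 := rfl

theorem augFun_isALinear (N : Submodule ℂ M) (hN : ∀ a, ∀ n ∈ N, H.act a n ∈ N)
    {q : M →ₗ[ℂ] A} (hq : H.IsALinear q) (Y : Set (M × ℕ)) :
    (H.augForm N hN Y).IsALinear (H.augFun N q Y) := fun a z => by
  rw [augFun_apply, augFun_apply, mul_add]
  exact congrArg₂ (· + ·) (hq a z.1) (H.companion_isALinear a z.2)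

theorem augForm_act_eq_zero (N : Submodule ℂ M) (hN : ∀ a, ∀ n ∈ N, H.act a n ∈ N)
    (Y : Set (M × ℕ)) {g : A} (hg : ∀ m, H.act g m = 0) (z : N × Finsupp.supported M ℂ Y) :
    (H.augForm N hN Y).act g z = 0 :=
  Prod.ext (Subtype.ext (hg _)) (Subtype.ext (Finsupp.ext fun _ => hg _))

theorem act_eq_zero (hdef : ∀ m, H.ip m m = 0 → m = 0) {g : A}
    (hg : ∀ m m', g * H.ip m m' = 0) (m : M) : H.act g m = 0 :=
  hdef _ (by rw [H.ip_act_left, hg])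

end Augmented

section Key
variable {A : Type u} [NonUnitalCStarAlgebra A] [PartialOrder A] [StarOrderedRing A]
  {M : Type v} [AddCommGroup M] [Module ℂ M] (H : HermForm A M)

theorem nonneg_of_augmented (hA : ExtensionProperty.{u, v} A)
    (hdef : ∀ m, H.ip m m = 0 → m = 0) (hH : ∀ m, 0 ≤ H.ip m m)
    (N : Submodule ℂ M) (hN : ∀ a, ∀ n ∈ N, H.act a n ∈ N) {q : M →ₗ[ℂ] A} (hq : H.IsALinear q)
    {Y : Set (M × ℕ)} (hY : H.CompatibleOn ⊤ q Y) (hYs : H.SaturatedOn N q Y)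
    {X : Type v} [AddCommGroup X] [Module ℂ X] (G : HermForm A X) (β : X →ₗ[ℂ] A)
    (hβ : G.IsALinear β) (hG : ∀ g, (∀ m, H.act g m = 0) → ∀ x, G.act g x = 0)
    (hpos : ∀ p, 0 ≤ ((H.augForm N hN Y).couple (H.augFun N q Y)
      (H.augFun_isALinear N hN hq Y) G β hβ).ip p p) (x : X) : 0 ≤ G.ip x x :=
  nonneg_of_couple_nonneg hA H hH (H.augForm N hN Y) (H.augFun N q Y)
    (H.augFun_isALinear N hN hq Y) (fun z => hY z.1 trivial z.2 z.2.2)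
    (fun y hy m => by
      rw [hYs y fun n hn t ht m => hy (⟨n, hn⟩, ⟨t, ht⟩) m, H.ip_zero_right])
    G β hβ (fun g hg => hG g (H.act_eq_zero hdef hg)) (fun _ _ => hpos _) x

theorem augForm_add_nonneg {N : Submodule ℂ M} (hN : ∀ a, ∀ n ∈ N, H.act a n ∈ N)
    {q : M →ₗ[ℂ] A} {Y : Set (M × ℕ)} (hY : H.CompatibleOn ⊤ q Y)
    (z : N × Finsupp.supported M ℂ Y) (β : A) (x : M) :
    0 ≤ (H.augForm N hN Y).ip z z + H.augFun N q Y z * star β + β * star (H.augFun N q Y z) +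
      β * star β + (1 / 2 : ℝ) • (H.ip z.1 x + H.ip x z.1) + (1 / 4 : ℝ) • H.ip x x +
      (1 / 2 : ℝ) • (q x * star β + β * star (q x)) := by
  have h1 := hY (z.1 + ((1 / 2 : ℝ) : ℂ) • x) trivial z.2 z.2.2
  rw [map_add, map_smul] at h1
  simp only [H.ip_add_left, H.ip_add_right, H.ip_real_smul_left, H.ip_real_smul_right] at h1
  have h2 := mul_star_self_nonneg
    (q z.1 + ((1 / 2 : ℝ) : ℂ) • q x + H.companion z.2 + β)
  refine (add_nonneg (sub_nonneg.2 h1) h2).trans_eq ?_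
  have e : (H.augForm N hN Y).ip z z = H.ip z.1 z.1 + (H.finsupp (M × ℕ)).ip z.2 z.2 := rfl
  rw [e, augFun_apply, Complex.coe_smul]
  simp only [star_add, star_smul, star_trivial, mul_add, add_mul, smul_mul_assoc, mul_smul_comm]
  module

theorem eq_zero_of_regular (hA : ExtensionProperty.{u, v} A)
    (hdef : ∀ m, H.ip m m = 0 → m = 0) (hH : ∀ m, 0 ≤ H.ip m m)
    (N : Submodule ℂ M) (hN : ∀ a, ∀ n ∈ N, H.act a n ∈ N) {q₀ q₁ q₂ : M →ₗ[ℂ] A}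
    (hq₀ : H.IsALinear q₀) (hq₁ : H.IsALinear q₁) (hq₂ : H.IsALinear q₂)
    (hr₀ : H.IsRegular N q₀) (hr₁ : H.IsRegular N q₁) (hr₂ : H.IsRegular N q₂) (b₀ b₁ b₂ : A)
    (hb : ∀ n ∈ N, q₀ n * b₀ + q₁ n * b₁ + q₂ n * b₂ = 0) (x : M) :
    q₀ x * b₀ + q₁ x * b₁ + q₂ x * b₂ = 0 := by
  obtain ⟨Y₀, hY₀, hs₀⟩ := hr₀
  obtain ⟨Y₁, hY₁, hs₁⟩ := hr₁
  obtain ⟨Y₂, hY₂, hs₂⟩ := hr₂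
  let δ : M →ₗ[ℂ] A := LinearMap.mulRight ℂ b₀ ∘ₗ q₀ + LinearMap.mulRight ℂ b₁ ∘ₗ q₁ +
    LinearMap.mulRight ℂ b₂ ∘ₗ q₂
  have hδ : ∀ x, δ x = q₀ x * b₀ + q₁ x * b₁ + q₂ x * b₂ := fun _ => rfl
  have hδa : H.IsALinear δ := fun a x => by
    rw [hδ, hδ, hq₀, hq₁, hq₂]; noncomm_ring
  have main : ∀ t : ℝ, 0 ≤ H.ip x x - t • (δ x * star (δ x)) := by
    intro t
    let β : A → M →ₗ[ℂ] A := fun b => (-t : ℂ) • (LinearMap.mulRight ℂ (star b) ∘ₗ δ)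
    have hβ : ∀ b x, β b x = -(t • (δ x * star b)) := fun b x => by
      change (-t : ℂ) • (δ x * star b) = _
      rw [neg_smul, Complex.coe_smul]
    have hβa : ∀ b, H.IsALinear (β b) := fun b a x => by
      rw [hβ, hβ, hδa, mul_neg, mul_smul_comm, mul_assoc]
    let G₃ := H.addCross ((-(t / 2) : ℂ) • δ) δ (fun a x => by
      rw [LinearMap.smul_apply, LinearMap.smul_apply, hδa, mul_smul_comm]) hδa
    have hG₃ : ∀ x, G₃.ip x x = H.ip x x - t • (δ x * star (δ x)) := fun x => by
      change H.ip x x + ((-(t / 2) : ℂ) • δ x * star (δ x) +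
        δ x * star ((-(t / 2) : ℂ) • δ x)) = _
      have e : (-(t / 2) : ℂ) = ((-(t / 2) : ℝ) : ℂ) := by push_cast; rfl
      rw [e, Complex.coe_smul, star_smul, star_trivial (-(t / 2)), smul_mul_assoc, mul_smul_comm]
      module
    have h₂ : G₃.IsALinear (β b₂) := hβa b₂
    let G₂ := (H.augForm N hN Y₂).couple (H.augFun N q₂ Y₂) (H.augFun_isALinear N hN hq₂ Y₂) G₃
      (β b₂) h₂
    have h₁ : G₂.IsALinear (β b₁ ∘ₗ LinearMap.snd ℂ _ _) := fun a p => hβa b₁ a p.2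
    let G₁ := (H.augForm N hN Y₁).couple (H.augFun N q₁ Y₁) (H.augFun_isALinear N hN hq₁ Y₁) G₂
      _ h₁
    have h₀ : G₁.IsALinear (β b₀ ∘ₗ LinearMap.snd ℂ _ _ ∘ₗ LinearMap.snd ℂ _ _) :=
      fun a p => hβa b₀ a p.2.2
    have f₂ : ∀ g, (∀ m, H.act g m = 0) → ∀ p, G₂.act g p = 0 := fun g hg p =>
      Prod.ext (H.augForm_act_eq_zero N hN Y₂ hg p.1) (hg p.2)
    have f₁ : ∀ g, (∀ m, H.act g m = 0) → ∀ p, G₁.act g p = 0 := fun g hg p =>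
      Prod.ext (H.augForm_act_eq_zero N hN Y₁ hg p.1) (f₂ g hg p.2)
    rw [← hG₃]
    refine H.nonneg_of_augmented hA hdef hH N hN hq₂ hY₂ hs₂ G₃ (β b₂) h₂
      (fun g hg => hg) (fun p => ?_) x
    refine H.nonneg_of_augmented hA hdef hH N hN hq₁ hY₁ hs₁ G₂ _ h₁ f₂ (fun p => ?_) p
    refine H.nonneg_of_augmented hA hdef hH N hN hq₀ hY₀ hs₀ G₁ _ h₀ f₁ (fun p => ?_) p
    obtain ⟨z₀, z₁, z₂, x⟩ := p
    simp only [G₁, G₂, couple_ip_self, LinearMap.comp_apply, LinearMap.snd_apply]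
    rw [hG₃]
    let n : N := z₀.1 + z₁.1 + z₂.1
    refine nonneg_of_forall_exists_norm_le fun ε hε => ?_
    obtain ⟨a, ha, hax, -⟩ := H.exists_approx_projection hH x n hε
    set x₀ := x - H.act a n with hx₀
    have hδ₀ : δ x₀ = δ x := by
      rw [hx₀, map_sub, hδ (H.act a n), hb _ (hN a n n.2), sub_zero]
    refine ⟨(1 / 2 : ℝ) • (H.ip n x₀ + H.ip x₀ n), ?_, ?_⟩
    · rw [H.ip_conj n x₀, norm_smul]
      calc _ ≤ ‖(1 / 2 : ℝ)‖ * (ε + ε) := by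
            gcongr
            exact (norm_add_le _ _).trans (add_le_add ((norm_star _).trans_le ha) ha)
        _ = ε := by rw [Real.norm_of_nonneg (by norm_num)]; ring
    have p₀ := H.augForm_add_nonneg hN hY₀ z₀ (β b₀ x) x₀
    have p₁ := H.augForm_add_nonneg hN hY₁ z₁ (β b₁ x) x₀
    have p₂ := H.augForm_add_nonneg hN hY₂ z₂ (β b₂ x) x₀
    have p₃ : 0 ≤ (3 / 4 : ℝ) • (H.ip x x - H.ip x₀ x₀) + (1 / 4 : ℝ) • H.ip x x :=
      add_nonneg (smul_nonneg (by norm_num) (sub_nonneg.2 hax)) (smul_nonneg (by norm_num) (hH x))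
    have hcross : q₀ x₀ * star (β b₀ x) + q₁ x₀ * star (β b₁ x) + q₂ x₀ * star (β b₂ x) =
        -(t • (δ x * star (δ x))) := by
      have h : q₀ x₀ * b₀ + q₁ x₀ * b₁ + q₂ x₀ * b₂ = δ x := hδ₀
      rw [show -(t • (δ x * star (δ x))) =
        -(t • ((q₀ x₀ * b₀ + q₁ x₀ * b₁ + q₂ x₀ * b₂) * star (δ x))) by rw [h]]
      simp only [hβ, star_neg, star_smul, star_trivial t, star_mul, star_star, mul_neg,
        mul_smul_comm, add_mul, mul_assoc, smul_add, neg_add]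
    have hcross' := congrArg star hcross
    simp only [star_add, star_mul, star_star, star_neg, star_smul, star_trivial] at hcross'
    refine (add_nonneg (add_nonneg (add_nonneg p₀ p₁) p₂) p₃).trans_eq ?_
    have e : H.ip (n : M) x₀ = H.ip z₀.1 x₀ + H.ip z₁.1 x₀ + H.ip z₂.1 x₀ := by
      rw [← H.ip_add_left, ← H.ip_add_left]; rfl
    have e' : H.ip x₀ (n : M) = H.ip x₀ z₀.1 + H.ip x₀ z₁.1 + H.ip x₀ z₂.1 := by
      rw [← H.ip_add_right, ← H.ip_add_right]; rfl
    rw [e, e']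
    linear_combination (norm := module) (1 / 2 : ℝ) • hcross + (1 / 2 : ℝ) • hcross'
  rw [← hδ, ← norm_le_zero_iff]
  by_contra hpos
  push Not at hpos
  have h1 := main ((‖H.ip x x‖ + 1) / ‖δ x‖ ^ 2)
  have h2 := CStarAlgebra.norm_le_norm_of_nonneg_of_le
    (smul_nonneg (by positivity) (mul_star_self_nonneg _)) (sub_nonneg.1 h1)
  rw [norm_smul, CStarRing.norm_self_mul_star, Real.norm_of_nonneg (by positivity), ← sq,
    div_mul_cancel₀ _ (by positivity)] at h2
  linarith

end Key
end HermForm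

namespace HermForm
section RegularVectors
variable {A : Type*} [NonUnitalCStarAlgebra A] [PartialOrder A] [StarOrderedRing A]
  {M : Type*} [AddCommGroup M] [Module ℂ M] (H : HermForm A M)

theorem toLin_isContraction (hH : ∀ m, 0 ≤ H.ip m m) {n : M} (hn : ‖H.ip n n‖ ≤ 1) :
    H.IsContraction (H.toLin n) := fun m => by
  change H.ip m n * star (H.ip m n) ≤ H.ip m m
  rw [← H.ip_conj]
  refine (H.cauchy_schwarz_le hH n m).trans ?_
  simpa using smul_le_smul_of_nonneg_right hn (hH m)

theorem toLin_isRegular (hdef : ∀ m, H.ip m m = 0 → m = 0) (hH : ∀ m, 0 ≤ H.ip m m)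
    (N : Submodule ℂ M) (hN : ∀ a, ∀ n ∈ N, H.act a n ∈ N) {n : M} (hn : n ∈ N)
    (hn1 : ‖H.ip n n‖ ≤ 1) : H.IsRegular N (H.toLin n) := by
  obtain ⟨Y, hY, hYs⟩ := H.exists_saturated hdef N (H.toLin n) (map_zero _)
    fun m _ => H.toLin_isContraction hH hn1 m
  refine ⟨Y, fun m _ t ht => sub_nonneg.1 (nonneg_of_forall_exists_norm_le fun ε hε => ?_), hYs⟩
  set c := H.toLin n m + H.companion t with hc
  obtain ⟨a, ha, -, ha'⟩ := H.exists_approx_projection hH m n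
    (ε := min 1 (ε / (2 * ‖c‖ + 1))) (by positivity)
  set e := H.ip (m - H.act a n) n with he
  have hce : c - e = H.toLin n (H.act a n) + H.companion t := by
    rw [hc, he, H.ip_sub_left]
    change H.ip m n + _ - _ = H.ip (H.act a n) n + _
    abel
  refine ⟨c * star e + e * star c - e * star e, ?_, ?_⟩
  · have h1 : ‖e‖ ≤ 1 := ha.trans (min_le_left _ _)
    have h2 : ‖e‖ ≤ ε / (2 * ‖c‖ + 1) := ha.trans (min_le_right _ _)
    calc _ ≤ ‖c * star e‖ + ‖e * star c‖ + ‖e * star e‖ :=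
          (norm_sub_le _ _).trans (add_le_add_left (norm_add_le _ _) _)
      _ ≤ ‖c‖ * ‖e‖ + ‖e‖ * ‖c‖ + ‖e‖ * ‖e‖ := by
          gcongr <;> exact (norm_mul_le _ _).trans_eq (by rw [norm_star])
      _ ≤ ‖c‖ * ‖e‖ + ‖e‖ * ‖c‖ + ‖e‖ * 1 := by gcongr
      _ = ‖e‖ * (2 * ‖c‖ + 1) := by ring
      _ ≤ ε := (le_div_iff₀ (by positivity)).1 h2
  · have h1 := hY _ (hN a n hn) t ht
    rw [← hce] at h1
    refine (add_nonneg (sub_nonneg.2 ha') (sub_nonneg.2 h1)).trans_eq ?_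
    rw [star_sub]
    noncomm_ring

end RegularVectors
end HermForm

section Submodule
variable {A : Type*} [NonUnitalCStarAlgebra A] {M : Type*} [NormedAddCommGroup M]
  [NormedSpace ℂ M] [SMul A M] [HilbertCStarModule A M]

/-- An isometric `A`-linear embedding `φ : N' → M'` extending the canonical embedding of `N`
into `M'`. -/
structure IsDualEmbedding (N : Set M) (φ : (M → A) → (M → A)) : Prop where
  isDualVector : ∀ r, IsDualVectorOn A N r → IsDualVector A (φ r)
  congr : ∀ r s, IsDualVectorOn A N r → IsDualVectorOn A N s → (∀ x ∈ N, r x = s x) → φ r = φ s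
  map_add : ∀ r s, IsDualVectorOn A N r → IsDualVectorOn A N s →
    φ (fun x => r x + s x) = fun x => φ r x + φ s x
  map_smulC : ∀ (c : ℂ) (r : M → A), IsDualVectorOn A N r →
    φ (fun x => c • r x) = fun x => c • φ r x
  map_smulA : ∀ (a : A) (r : M → A), IsDualVectorOn A N r →
    φ (fun x => r x * star a) = fun x => φ r x * star a
  norm_eq : ∀ r, IsDualVectorOn A N r → dualNorm A (φ r) = dualNormOn A N r
  map_toDualFun : ∀ n ∈ N, φ (toDualFun A n) = toDualFun A n

/-- The complex subspace underlying a Hilbert submodule. -/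
def IsHilbertSubmodule.toSubmodule {N : Set M} (hN : IsHilbertSubmodule A N) : Submodule ℂ M where
  carrier := N
  add_mem' hx hy := hN.add_mem hx hy
  zero_mem' := hN.zero_mem
  smul_mem' c _ hx := hN.smulC_mem c hx

variable [PartialOrder A]

/-- Scalar multiples of regular functionals. -/
def IsRegularMultiple {N : Set M} (hN : IsHilbertSubmodule A N) (R : M → A) : Prop :=
  ∃ (c : ℂ) (q : M →ₗ[ℂ] A), (HermForm.ofHilbert A M).IsALinear q ∧
    (HermForm.ofHilbert A M).IsRegular hN.toSubmodule q ∧ ∀ x, R x = c • q x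

variable [StarOrderedRing A]

theorem toDualFun_isRegularMultiple {N : Set M} (hN : IsHilbertSubmodule A N) {n : M}
    (hn : n ∈ N) : IsRegularMultiple hN (toDualFun A n) := by
  let H := HermForm.ofHilbert A M
  have hpos : 0 < ‖n‖ + 1 := by positivity
  set n' : M := (((‖n‖ + 1)⁻¹ : ℝ) : ℂ) • n with hn'
  have hnn : n = ((‖n‖ + 1 : ℝ) : ℂ) • n' := by
    rw [hn', smul_smul, ← Complex.ofReal_mul, mul_inv_cancel₀ hpos.ne', Complex.ofReal_one,
      one_smul]
  refine ⟨((‖n‖ + 1 : ℝ) : ℂ), H.toLin n', H.toLin_isALinear n', ?_, fun x => ?_⟩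
  · refine H.toLin_isRegular (fun m => HermForm.ofHilbert_eq_zero A) (HermForm.ofHilbert_nonneg A)
      hN.toSubmodule (fun a n hn => hN.smulA_mem a hn) (hN.smulC_mem _ hn) ?_
    rw [← HermForm.ofHilbert_norm_sq, hn', norm_smul, Complex.norm_real,
      Real.norm_of_nonneg (by positivity)]
    refine pow_le_one₀ (by positivity) ?_
    rw [inv_mul_le_iff₀ hpos]; linarith
  · change H.ip x n = _ • H.ip x n'
    conv_lhs => rw [hnn]
    rw [H.ip_real_smul_right, Complex.coe_smul]

end Submodule

section Embedding
variable {A : Type u} [NonUnitalCStarAlgebra A] [PartialOrder A] [StarOrderedRing A]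
  {M : Type v} [NormedAddCommGroup M] [NormedSpace ℂ M] [SMul A M] [HilbertCStarModule A M]

theorem IsRegularMultiple.eq_zero (hA : ExtensionProperty.{u, v} A) {N : Set M}
    {hN : IsHilbertSubmodule A N} {R₀ R₁ R₂ : M → A} (h₀ : IsRegularMultiple hN R₀)
    (h₁ : IsRegularMultiple hN R₁) (h₂ : IsRegularMultiple hN R₂) (b₀ b₁ b₂ : A)
    (hb : ∀ n ∈ N, R₀ n * b₀ + R₁ n * b₁ + R₂ n * b₂ = 0) (x : M) :
    R₀ x * b₀ + R₁ x * b₁ + R₂ x * b₂ = 0 := by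
  obtain ⟨c₀, q₀, ha₀, hr₀, e₀⟩ := h₀
  obtain ⟨c₁, q₁, ha₁, hr₁, e₁⟩ := h₁
  obtain ⟨c₂, q₂, ha₂, hr₂, e₂⟩ := h₂
  simp only [e₀, e₁, e₂, smul_mul_assoc, ← mul_smul_comm] at hb ⊢
  exact (HermForm.ofHilbert A M).eq_zero_of_regular hA (fun m => HermForm.ofHilbert_eq_zero A)
    (HermForm.ofHilbert_nonneg A) hN.toSubmodule (fun a n hn => hN.smulA_mem a hn)
    ha₀ ha₁ ha₂ hr₀ hr₁ hr₂ _ _ _ hb x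

theorem IsRegularMultiple.ext (hA : ExtensionProperty.{u, v} A) {N : Set M}
    {hN : IsHilbertSubmodule A N} {R S : M → A} (hR : IsRegularMultiple hN R)
    (hS : IsRegularMultiple hN S) (h : ∀ n ∈ N, R n = S n) : R = S := by
  funext x
  have := hR.eq_zero hA hS hS (star (R x - S x)) (-star (R x - S x)) 0
    (fun n hn => by rw [h n hn]; noncomm_ring) x
  rw [mul_zero, add_zero, mul_neg, ← sub_eq_add_neg, ← sub_mul] at this
  exact sub_eq_zero.1 ((CStarRing.mul_star_self_eq_zero_iff _).1 this)

theorem exists_isRegularMultiple (hA : ExtensionProperty.{u, v} A) {N : Set M}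
    (hN : IsHilbertSubmodule A N) {r : M → A} (hr : IsDualVectorOn A N r) :
    ∃ R : M → A, IsRegularMultiple hN R ∧ IsDualVector A R ∧ dualNorm A R = dualNormOn A N r ∧
      ∀ n ∈ N, R n = r n := by
  set l := dualNormOn A N r with hl
  have hl0 : 0 ≤ l := dualNormOn_nonneg N r
  have hle : ∀ n ∈ N, ‖r n‖ ≤ l * ‖n‖ := fun n hn => norm_le_dualNormOn hr hn
  let r' : hN.toSubmodule →ₗ[ℂ] A :=
    { toFun := fun n => (l⁻¹ : ℂ) • r n
      map_add' := fun x y => by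
        rw [Submodule.coe_add, hr.map_add x x.2 y y.2, smul_add]
      map_smul' := fun c x => by
        rw [Submodule.coe_smul, hr.map_smulC c x x.2, smul_comm]; rfl }
  have hr' : ∀ n, r' n = (l⁻¹ : ℂ) • r n := fun _ => rfl
  have hra : ((HermForm.ofHilbert A M).restrict hN.toSubmodule
      fun a n hn => hN.smulA_mem a hn).IsALinear r' := fun a n => by
    rw [hr', hr', mul_smul_comm, ← hr.map_smulA a n n.2]; rfl
  obtain ⟨q, hqa, hqr, hq⟩ := (HermForm.ofHilbert A M).exists_regular_extension hA
    (fun m => HermForm.ofHilbert_eq_zero A) (HermForm.ofHilbert_nonneg A) hN.toSubmodule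
    (fun a n hn => hN.smulA_mem a hn) r' hra (fun n => by
      have := HermForm.mul_star_le_of_norm_le
        ((HermForm.ofHilbert A M).restrict hN.toSubmodule fun a n hn => hN.smulA_mem a hn)
        (fun p => HermForm.ofHilbert_nonneg A (p : M)) r' hra 1 (fun p => by
          change _ ≤ 1 ^ 2 * ‖(HermForm.ofHilbert A M).ip (p : M) p‖
          rw [one_pow, one_mul, ← HermForm.ofHilbert_norm_sq, hr', norm_smul, norm_inv,
            Complex.norm_real, Real.norm_of_nonneg hl0]
          refine pow_le_pow_left₀ (by positivity) ?_ 2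
          rcases hl0.eq_or_lt with h0 | h0
          · rw [← h0]; simp
          · rw [inv_mul_le_iff₀ h0]; exact hle p p.2) n
      simpa using this)
  have hqn : ∀ x, ‖q x‖ ≤ ‖x‖ := fun x => by
    obtain ⟨Y, hY, -⟩ := hqr
    have h1 := hY x trivial 0 (Submodule.zero_mem _)
    rw [map_zero, add_zero, HermForm.ip_zero_left, add_zero] at h1
    have h2 := CStarAlgebra.norm_le_norm_of_nonneg_of_le (mul_star_self_nonneg _) h1
    rw [CStarRing.norm_self_mul_star, ← HermForm.ofHilbert_norm_sq, ← sq] at h2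
    exact le_of_sq_le_sq h2 (norm_nonneg _)
  have hRn : ∀ x, ‖(l : ℂ) • q x‖ ≤ l * ‖x‖ := fun x => by
    rw [norm_smul, Complex.norm_real, Real.norm_of_nonneg hl0]
    exact mul_le_mul_of_nonneg_left (hqn x) hl0
  have hR : IsDualVector A fun x => (l : ℂ) • q x :=
    { map_add := fun x y => by rw [map_add, smul_add]
      map_smulC := fun c x => by rw [map_smul, smul_comm]
      map_smulA := fun a x => by
        rw [mul_smul_comm]; exact congrArg _ (hqa a x)
      bound := ⟨l, hRn⟩ }
  have hext : ∀ n ∈ N, (l : ℂ) • q n = r n := fun n hn => by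
    rw [hq ⟨n, hn⟩, hr', smul_smul]
    rcases hl0.eq_or_lt with h0 | h0
    · have := hle n hn
      rw [← h0, zero_mul] at this
      rw [norm_le_zero_iff.1 this, smul_zero]
    · rw [mul_inv_cancel₀ (by exact_mod_cast h0.ne'), one_smul]
  refine ⟨_, ⟨l, q, hqa, hqr, fun x => rfl⟩, hR, le_antisymm ?_ ?_, hext⟩
  · rw [dualNorm_eq_dualNormOn_univ]
    exact dualNormOn_le hl0 fun x _ => hRn x
  · refine dualNormOn_le (Real.sInf_nonneg fun _ h => h.1) fun n hn => ?_
    rw [← hext n hn]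
    exact norm_le_dualNorm hR n

section DualOn
variable {N : Set M} {r s : M → A}

omit [PartialOrder A] [StarOrderedRing A] [HilbertCStarModule A M]

theorem IsDualVectorOn.add (hr : IsDualVectorOn A N r) (hs : IsDualVectorOn A N s) :
    IsDualVectorOn A N fun x => r x + s x where
  map_add x hx y hy := by rw [hr.map_add x hx y hy, hs.map_add x hx y hy]; abel
  map_smulC c x hx := by rw [hr.map_smulC c x hx, hs.map_smulC c x hx, smul_add]
  map_smulA a x hx := by rw [hr.map_smulA a x hx, hs.map_smulA a x hx, mul_add]
  bound := by
    obtain ⟨C, hC⟩ := hr.bound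
    obtain ⟨D, hD⟩ := hs.bound
    refine ⟨C + D, fun x hx => (norm_add_le _ _).trans ?_⟩
    rw [add_mul]
    exact add_le_add (hC x hx) (hD x hx)

theorem IsDualVectorOn.smul (hr : IsDualVectorOn A N r) (c : ℂ) :
    IsDualVectorOn A N fun x => c • r x where
  map_add x hx y hy := by rw [hr.map_add x hx y hy, smul_add]
  map_smulC d x hx := by rw [hr.map_smulC d x hx, smul_comm]
  map_smulA a x hx := by rw [hr.map_smulA a x hx, mul_smul_comm]
  bound := by
    obtain ⟨C, hC⟩ := hr.bound
    refine ⟨‖c‖ * C, fun x hx => ?_⟩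
    rw [norm_smul, mul_assoc]
    exact mul_le_mul_of_nonneg_left (hC x hx) (norm_nonneg c)

theorem IsDualVectorOn.mul_right (hr : IsDualVectorOn A N r) (a : A) :
    IsDualVectorOn A N fun x => r x * a where
  map_add x hx y hy := by rw [hr.map_add x hx y hy, add_mul]
  map_smulC d x hx := by rw [hr.map_smulC d x hx, smul_mul_assoc]
  map_smulA b x hx := by rw [hr.map_smulA b x hx, mul_assoc]
  bound := by
    obtain ⟨C, hC⟩ := hr.bound
    refine ⟨C * ‖a‖, fun x hx => (norm_mul_le _ _).trans ?_⟩
    rw [mul_right_comm]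
    exact mul_le_mul_of_nonneg_right (hC x hx) (norm_nonneg a)

end DualOn

omit [PartialOrder A] [StarOrderedRing A] in
theorem toDualFun_isDualVector (n : M) : IsDualVector A (toDualFun A n) where
  map_add x y := (HermForm.ofHilbert A M).ip_add_left x y n
  map_smulC c x := (HermForm.ofHilbert A M).ip_smul_left c x n
  map_smulA a x := (HermForm.ofHilbert A M).ip_act_left a x n
  bound := by
    let _ := CStarAlgebra.spectralOrder A
    have := CStarAlgebra.spectralOrderedRing A
    exact ⟨‖n‖, fun x => (HermForm.ofHilbert_norm_le A x n).trans_eq (mul_comm _ _)⟩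

theorem exists_dual_embedding (hA : ExtensionProperty.{u, v} A) {N : Set M}
    (hN : IsHilbertSubmodule A N) :
    ∃ φ : (M → A) → (M → A), IsDualEmbedding N φ := by
  classical
  choose! φ hreg hdual hnorm hext using
    fun (r : M → A) (hr : IsDualVectorOn A N r) => exists_isRegularMultiple hA hN hr
  refine ⟨φ, hdual, fun r s hr hs h => ?_, fun r s hr hs => funext fun x => ?_,
    fun c r hr => funext fun x => ?_, fun a r hr => funext fun x => ?_, hnorm, fun n hn => ?_⟩
  · exact (hreg r hr).ext hA (hreg s hs) fun n hn => by rw [hext r hr n hn, hext s hs n hn, h n hn]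
  · have hrs := hr.add hs
    set d := φ (fun x => r x + s x) x - (φ r x + φ s x) with hd
    have := (hreg _ hrs).eq_zero hA (hreg r hr) (hreg s hs) (star d) (-star d) (-star d)
      (fun n hn => by rw [hext _ hrs n hn, hext r hr n hn, hext s hs n hn]; noncomm_ring) x
    have e : d * star d = 0 := by rw [← this, hd]; noncomm_ring
    exact sub_eq_zero.1 ((CStarRing.mul_star_self_eq_zero_iff _).1 e)
  · have hc := hr.smul c
    set d := φ (fun x => c • r x) x - c • φ r x with hd
    have := (hreg _ hc).eq_zero hA (hreg r hr) (hreg r hr) (star d) (-(c • star d)) 0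
      (fun n hn => by
        rw [hext _ hc n hn, hext r hr n hn, mul_neg, mul_smul_comm, smul_mul_assoc]; simp) x
    have e : d * star d = 0 := by
      rw [← this, mul_zero, add_zero, mul_neg, mul_smul_comm, ← smul_mul_assoc, ← sub_eq_add_neg,
        ← sub_mul]
    exact sub_eq_zero.1 ((CStarRing.mul_star_self_eq_zero_iff _).1 e)
  · have ha := hr.mul_right (star a)
    set d := φ (fun x => r x * star a) x - φ r x * star a with hd
    have := (hreg _ ha).eq_zero hA (hreg r hr) (hreg r hr) (star d) (-(star a * star d)) 0
      (fun n hn => by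
        rw [hext _ ha n hn, hext r hr n hn, mul_neg, mul_assoc]; simp) x
    have e : d * star d = 0 := by
      rw [← this, mul_zero, add_zero, mul_neg, ← mul_assoc, ← sub_eq_add_neg, ← sub_mul]
    exact sub_eq_zero.1 ((CStarRing.mul_star_self_eq_zero_iff _).1 e)
  · have hn' := (toDualFun_isDualVector (A := A) n).isDualVectorOn N
    exact (hreg _ hn').ext hA (toDualFun_isRegularMultiple hN hn) (hext _ hn')

end Embedding

theorem cfcₙ_mul_of_continuous {A : Type*} [NonUnitalCStarAlgebra A] {f g k : ℝ → ℝ}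
    (hf : Continuous f) (hg : Continuous g) (hf0 : f 0 = 0) (hg0 : g 0 = 0) {a : A}
    (hk : ∀ x, 0 ≤ x → f x * g x = k x) (ha : ∀ x ∈ quasispectrum ℝ a, 0 ≤ x) :
    cfcₙ f a * cfcₙ g a = cfcₙ k a := by
  rw [← cfcₙ_mul f g a hf.continuousOn hf0 hg.continuousOn hg0]
  exact cfcₙ_congr fun x hx => hk x (ha x hx)

/-- Cutting off a positive element near `0`. -/
theorem exists_cutoff {A : Type*} [NonUnitalCStarAlgebra A] [PartialOrder A]
    [StarOrderedRing A] {h : A} (hh : 0 ≤ h) {c : ℝ} (hc : 0 < c) :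
    ∃ u l p : A, IsSelfAdjoint l ∧ IsSelfAdjoint (p * l) ∧ l * h * u = l ∧
      u * h * (p * l) = p * l ∧ ‖l * h * l‖ ≤ 1 ∧ p * (l * h * l) = p ∧
      ‖h - p * l‖ ≤ 2 * c := by
  have hq : ∀ x ∈ quasispectrum ℝ h, 0 ≤ x := fun x hx => quasispectrum_nonneg_of_nonneg h hh x hx
  have hid : cfcₙ (fun x : ℝ => x) h = h := cfcₙ_id' ℝ h
  let m : ℝ → ℝ := fun x => max x c
  have hm : ∀ x, 0 < m x := fun x => hc.trans_le (le_max_right _ _)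
  have hmc : Continuous m := continuous_id.max continuous_const
  let k : ℝ → ℝ := fun x => max 0 (min 1 ((x - c) / c))
  have hkc : Continuous k := by fun_prop
  have hk0 : ∀ x, 0 ≤ k x := fun x => le_max_left _ _
  have hk1 : ∀ x, k x ≤ 1 := fun x => max_le zero_le_one (min_le_left _ _)
  have hkz : ∀ x, x ≤ c → k x = 0 := fun x hx => max_eq_left
    ((min_le_right _ _).trans (div_nonpos_of_nonpos_of_nonneg (by linarith) hc.le))
  have hko : ∀ x, 2 * c ≤ x → k x = 1 := fun x hx => by
    have : 1 ≤ (x - c) / c := by rw [le_div_iff₀ hc]; linarith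
    simp only [k, min_eq_left this, max_eq_right zero_le_one]
  let U : ℝ → ℝ := fun x => min (max x 0) c / (c * m x)
  let L : ℝ → ℝ := fun x => k x / √(m x)
  let D : ℝ → ℝ := fun x => max 0 (x - 2 * c)
  let P : ℝ → ℝ := fun x => √(m x) * D x
  have hUc : Continuous U := Continuous.div (by fun_prop) (by fun_prop)
    fun x => (mul_pos hc (hm x)).ne'
  have hLc : Continuous L := hkc.div hmc.sqrt fun x => (Real.sqrt_pos.2 (hm x)).ne'
  have hDc : Continuous D := by fun_prop
  have hPc : Continuous P := hmc.sqrt.mul hDc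
  have hU0 : U 0 = 0 := by simp [U, hc.le]
  have hL0 : L 0 = 0 := by simp [L, hkz 0 hc.le]
  have hD0 : D 0 = 0 := by simp [D, hc.le]
  have hP0 : P 0 = 0 := by simp [P, hD0]
  have hmx : ∀ x, c ≤ x → m x = x := fun x hx => max_eq_left hx
  have hxU : ∀ x, c ≤ x → x * U x = 1 := fun x hx => by
    have hx0 : 0 < x := hc.trans_le hx
    simp only [U, hmx x hx, max_eq_left hx0.le, min_eq_right hx]
    field_simp
  have hLU : ∀ x, L x * x * U x = L x := fun x => by
    rcases le_total x c with hx | hx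
    · simp [L, hkz x hx]
    · rw [mul_assoc, hxU x hx, mul_one]
  have hDz : ∀ x, x ≤ 2 * c → D x = 0 := fun x hx => max_eq_left (by linarith)
  have hPL : ∀ x, P x * L x = D x := fun x => by
    rcases le_total x (2 * c) with hx | hx
    · simp [P, hDz x hx]
    · have := (Real.sqrt_pos.2 (hm x)).ne'
      simp only [P, L, hko x hx]
      field_simp
  have hLL : ∀ x, L x * x * L x = k x ^ 2 * (x / m x) := fun x => by
    simp only [L]
    rw [div_mul_eq_mul_div, div_mul_div_comm, Real.mul_self_sqrt (hm x).le]
    ring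
  have hLhc : Continuous fun x => L x * x := hLc.mul continuous_id
  have hLLc : Continuous fun x => L x * x * L x := hLhc.mul hLc
  have e1 : cfcₙ L h * h = cfcₙ (fun x => L x * x) h := by
    simpa only [hid] using cfcₙ_mul_of_continuous (g := fun x : ℝ => x) hLc continuous_id hL0 rfl
      (fun _ _ => rfl) hq
  have e2 : cfcₙ L h * h * cfcₙ L h = cfcₙ (fun x => L x * x * L x) h := by
    rw [e1]
    exact cfcₙ_mul_of_continuous hLhc hLc (by simp) hL0 (fun _ _ => rfl) hq
  have e3 : cfcₙ P h * cfcₙ L h = cfcₙ D h :=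
    cfcₙ_mul_of_continuous hPc hLc hP0 hL0 (fun x _ => hPL x) hq
  have e4 : cfcₙ U h * h = cfcₙ (fun x => U x * x) h := by
    simpa only [hid] using cfcₙ_mul_of_continuous (g := fun x : ℝ => x) hUc continuous_id hU0 rfl
      (fun _ _ => rfl) hq
  refine ⟨cfcₙ U h, cfcₙ L h, cfcₙ P h, cfcₙ_predicate L h, ?_, ?_, ?_, ?_, ?_, ?_⟩
  · rw [e3]; exact cfcₙ_predicate D h
  · rw [e1]
    exact cfcₙ_mul_of_continuous hLhc hUc (by simp) hU0 (fun x _ => hLU x) hq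
  · rw [e3, e4]
    refine cfcₙ_mul_of_continuous (hUc.mul continuous_id) hDc (by simp) hD0 (fun x _ => ?_) hq
    rcases le_total x (2 * c) with hx | hx
    · simp [hDz x hx]
    · change U x * x * D x = D x
      rw [mul_comm (U x), hxU x (by linarith), one_mul]
  · rw [e2]
    refine norm_cfcₙ_le fun x hx => ?_
    have h0 := hq x hx
    have h1 : x / m x ≤ 1 := (div_le_one (hm x)).2 (le_max_left _ _)
    have h2 : 0 ≤ x / m x := div_nonneg h0 (hm x).le
    rw [hLL, Real.norm_of_nonneg (by positivity)]
    exact mul_le_one₀ (pow_le_one₀ (hk0 x) (hk1 x)) h2 h1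
  · rw [e2]
    refine cfcₙ_mul_of_continuous hPc hLLc hP0 (by simp [hL0]) (fun x _ => ?_) hq
    rcases le_total x (2 * c) with hx | hx
    · simp [P, hDz x hx]
    · have hx0 : x ≠ 0 := by linarith
      rw [hLL, hko x hx, hmx x (by linarith), div_self hx0]; ring
  · rw [e3]
    have : h - cfcₙ D h = cfcₙ (fun x => x - D x) h := by
      rw [cfcₙ_sub (fun x => x) D h continuous_id.continuousOn rfl hDc.continuousOn hD0, hid]
    rw [this]
    refine norm_cfcₙ_le fun x hx => ?_
    have h0 := hq x hx
    rw [Real.norm_eq_abs, abs_le]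
    simp only [D]
    constructor <;> rcases max_cases 0 (x - 2 * c) with h | h <;> linarith

section Extension
variable {A : Type*} [NonUnitalCStarAlgebra A] [PartialOrder A] [StarOrderedRing A]
  {M : Type*} [NormedAddCommGroup M] [NormedSpace ℂ M] [SMul A M] [HilbertCStarModule A M]
  {N : Set M} {r ρ : M → A}

omit [NonUnitalCStarAlgebra A] [PartialOrder A] [StarOrderedRing A] [HilbertCStarModule A M] in
theorem IsHilbertSubmodule.univ : IsHilbertSubmodule A (Set.univ : Set M) where
  isClosed := isClosed_univ
  zero_mem := trivial
  add_mem _ _ _ _ := trivial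
  smulC_mem _ _ _ := trivial
  smulA_mem _ _ _ := trivial

theorem IsDualVectorOn.mul_star_le (hr : IsDualVectorOn A N r) (hN : IsHilbertSubmodule A N)
    {K : ℝ} (hK : ∀ x ∈ N, ‖r x‖ ≤ K * ‖x‖) {x : M} (hx : x ∈ N) :
    r x * star (r x) ≤ K ^ 2 • (HermForm.ofHilbert A M).ip x x := by
  let r' : hN.toSubmodule →ₗ[ℂ] A :=
    { toFun := fun n => r n
      map_add' := fun x y => hr.map_add x x.2 y y.2
      map_smul' := fun c x => hr.map_smulC c x x.2 }
  refine HermForm.mul_star_le_of_norm_le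
    ((HermForm.ofHilbert A M).restrict hN.toSubmodule fun a n hn => hN.smulA_mem a hn)
    (fun p => HermForm.ofHilbert_nonneg A (p : M)) r' (fun a n => hr.map_smulA a n n.2) K
    (fun p => ?_) ⟨x, hx⟩
  change _ ≤ K ^ 2 * ‖(HermForm.ofHilbert A M).ip (p : M) p‖
  rw [← HermForm.ofHilbert_norm_sq, ← mul_pow]
  exact pow_le_pow_left₀ (norm_nonneg _) (hK p p.2) 2

theorem IsDualVector.mul_star_le (hr : IsDualVector A r) {K : ℝ} (hK : ∀ x, ‖r x‖ ≤ K * ‖x‖)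
    (x : M) : r x * star (r x) ≤ K ^ 2 • (HermForm.ofHilbert A M).ip x x :=
  (hr.isDualVectorOn Set.univ).mul_star_le .univ (fun x _ => hK x) trivial

omit [PartialOrder A] [StarOrderedRing A] [HilbertCStarModule A M] in
theorem IsDualVectorOn.exists_pos_bound (hr : IsDualVectorOn A N r) :
    ∃ K : ℝ, 0 < K ∧ ∀ x ∈ N, ‖r x‖ ≤ K * ‖x‖ :=
  ⟨dualNormOn A N r + 1, add_pos_of_nonneg_of_pos (dualNormOn_nonneg N r) one_pos,
    fun x hx => (norm_le_dualNormOn hr hx).trans (by gcongr; linarith)⟩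

theorem norm_sq_ip_add_smul_le (hN : IsHilbertSubmodule A N) (hρ : IsDualVectorOn A N ρ) {e : M}
    (he : e ∈ N) (he1 : ‖(HermForm.ofHilbert A M).ip e e‖ ≤ 1)
    (hρe : ρ e = 0) {K : ℝ} (hK0 : 0 < K)
    (hK : ∀ x ∈ N, ‖ρ x‖ ≤ K * ‖x‖) {t : ℝ} (ht : 0 < t) {x : M} (hx : x ∈ N) :
    ‖(HermForm.ofHilbert A M).ip x e + (t : ℂ) • ρ x‖ ^ 2 ≤ (1 + t ^ 2 * K ^ 2) * ‖x‖ ^ 2 := by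
  let H := HermForm.ofHilbert A M
  set α : A := (HermForm.ofHilbert A M).ip x e with hα
  set y : M := x + (-1 : ℂ) • α • e with hy
  have hαe : α • e ∈ N := hN.smulA_mem α he
  have hyN : y ∈ N := hN.add_mem hx (hN.smulC_mem _ hαe)
  have hρy : ρ y = ρ x := by
    rw [hy, hρ.map_add x hx _ (hN.smulC_mem _ hαe), hρ.map_smulC _ _ hαe, hρ.map_smulA _ _ he,
      hρe, mul_zero, smul_zero, add_zero]
  have hαx : H.ip e x = star α := H.ip_conj e x
  have hyy : H.ip y y = H.ip x x - (2 : ℝ) • (α * star α) + α * H.ip e e * star α := by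
    have : y = x - H.act α e := by rw [hy, neg_one_smul, ← sub_eq_add_neg]; rfl
    rw [this]
    simp only [H.ip_sub_left, H.ip_sub_right, H.ip_act_left, H.ip_act_right, hαx,
      show H.ip x e = α from rfl]
    rw [two_smul, mul_assoc α (H.ip e e)]
    abel
  have hα1 : α * H.ip e e * star α ≤ α * star α := by
    refine (CStarAlgebra.star_right_conjugate_le_norm_smul
      (hb := H.isSelfAdjoint_ip_self e)).trans ?_
    simpa using smul_le_smul_of_nonneg_right he1 (mul_star_self_nonneg α)
  have hyle : H.ip y y ≤ H.ip x x - α * star α := by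
    rw [hyy, two_smul]
    calc _ ≤ H.ip x x - (α * star α + α * star α) + α * star α := by gcongr
      _ = _ := by abel
  set s := t * K with hs
  have hs0 : 0 < s := mul_pos ht hK0
  set β : A := t • ρ x with hβ
  have hββ : β * star β ≤ s ^ 2 • (H.ip x x - α * star α) := by
    have h1 := hρ.mul_star_le hN hK hyN
    rw [hρy] at h1
    have e1 : β * star β = t ^ 2 • (ρ x * star (ρ x)) := by
      rw [hβ, star_smul, smul_mul_smul_comm, star_trivial, sq]
    rw [e1, hs, mul_pow, mul_smul]
    exact smul_le_smul_of_nonneg_left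
      (h1.trans (smul_le_smul_of_nonneg_left hyle (sq_nonneg K))) (sq_nonneg t)
  have hpos : 0 ≤ (s • α - s⁻¹ • β) * star (s • α - s⁻¹ • β) := mul_star_self_nonneg _
  have hsum : (α + β) * star (α + β) ≤ (1 + t ^ 2 * K ^ 2) • H.ip x x := by
    have h2 := smul_le_smul_of_nonneg_left hββ (show 0 ≤ 1 + (s ^ 2)⁻¹ by positivity)
    have h3 := add_nonneg hpos (sub_nonneg.2 h2)
    refine sub_nonneg.1 (h3.trans_eq ?_)
    clear_value β
    rw [← mul_pow, ← hs, smul_smul,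
      show (1 + (s ^ 2)⁻¹) * s ^ 2 = 1 + s ^ 2 by field_simp; ring]
    simp only [star_sub, star_add, star_smul, star_trivial, sub_mul, mul_sub, add_mul, mul_add,
      smul_mul_smul_comm, mul_inv_cancel₀ hs0.ne', inv_mul_cancel₀ hs0.ne']
    rw [show s⁻¹ * s⁻¹ = (s ^ 2)⁻¹ by rw [sq]; exact (mul_inv s s).symm]
    module
  have h4 := CStarAlgebra.norm_le_norm_of_nonneg_of_le (mul_star_self_nonneg _) hsum
  rw [CStarRing.norm_self_mul_star, ← sq, norm_smul, Real.norm_of_nonneg (by positivity),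
    ← HermForm.ofHilbert_norm_sq] at h4
  rwa [Complex.coe_smul]

theorem eq_zero_of_forall_norm_le_mul {B : Type*} [NormedAddCommGroup B] {x : B} {C : ℝ}
    (h : ∀ t : ℝ, 0 < t → ‖x‖ ≤ t * C) : x = 0 := by
  by_contra hx
  have hx : 0 < ‖x‖ := norm_pos_iff.2 hx
  have hC : 0 < |C| + 1 := by positivity
  have h1 := h (‖x‖ / (2 * (|C| + 1))) (by positivity)
  have h2 : ‖x‖ / (2 * (|C| + 1)) * C ≤ ‖x‖ / (2 * (|C| + 1)) * (|C| + 1) := by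
    gcongr; linarith [le_abs_self C]
  have h3 : ‖x‖ / (2 * (|C| + 1)) * (|C| + 1) = ‖x‖ / 2 := by field_simp
  linarith

variable {φ : (M → A) → (M → A)}

theorem IsDualEmbedding.mul_apply_eq_zero (hφ : IsDualEmbedding N φ) (hN : IsHilbertSubmodule A N)
    (hρ : IsDualVectorOn A N ρ) {e : M} (he : e ∈ N)
    (he1 : ‖(HermForm.ofHilbert A M).ip e e‖ ≤ 1) (hρe : ρ e = 0)
    {p : A} (hp : p * (HermForm.ofHilbert A M).ip e e = p) : p * φ ρ e = 0 := by
  set w := φ ρ e with hw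
  set P : A := (HermForm.ofHilbert A M).ip e e with hP
  set ρ' : M → A := fun x => ρ x * star w with hρ'
  have hd : IsDualVectorOn A N ρ' := hρ.mul_right _
  have hφe : φ ρ' e = w * star w := congrFun (hφ.map_smulA w ρ hρ) e
  have hρe' : ρ' e = 0 := by rw [hρ']; simp [hρe]
  obtain ⟨K, hK0, hK⟩ := hd.exists_pos_bound
  have key : p * (w * star w) * star p = 0 := by
    refine eq_zero_of_forall_norm_le_mul (C := K ^ 2 / 2 * ‖p * star p‖) fun t ht => ?_
    have he' := (toDualFun_isDualVector (A := A) e).isDualVectorOn N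
    have hσ := he'.add (hd.smul (t : ℂ))
    have hσe : φ (fun x => toDualFun A e x + (t : ℂ) • ρ' x) e = P + t • (w * star w) := by
      rw [hφ.map_add _ _ he' (hd.smul _), hφ.map_smulC _ _ hd, hφ.map_toDualFun e he]
      change P + (t : ℂ) • φ ρ' e = _
      rw [hφe, Complex.coe_smul]
    have hn : dualNorm A (φ fun x => toDualFun A e x + (t : ℂ) • ρ' x) ≤
        √(1 + t ^ 2 * K ^ 2) := by
      rw [hφ.norm_eq _ hσ]
      refine dualNormOn_le (Real.sqrt_nonneg _) fun x hx => ?_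
      refine le_of_sq_le_sq ?_ (by positivity)
      rw [mul_pow, Real.sq_sqrt (by positivity)]
      exact norm_sq_ip_add_smul_le hN hd he he1 hρe' hK0 hK ht hx
    have h1 := (hφ.isDualVector _ hσ).mul_star_le (K := √(1 + t ^ 2 * K ^ 2))
      (fun x => (norm_le_dualNorm (hφ.isDualVector _ hσ) x).trans (by gcongr)) e
    rw [hσe, Real.sq_sqrt (by positivity), ← hP] at h1
    have h2 := star_right_conjugate_le_conjugate h1 p
    have hPs : star P = P := (HermForm.ofHilbert A M).isSelfAdjoint_ip_self e
    have hPp : P * star p = star p := by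
      conv_rhs => rw [← hp, star_mul, hPs]
    have h3 : (2 * t) • (p * (w * star w) * star p) ≤ (t ^ 2 * K ^ 2) • (p * star p) := by
      have h4 : 0 ≤ t ^ 2 • ((p * (w * star w)) * star (p * (w * star w))) :=
        smul_nonneg (sq_nonneg t) (mul_star_self_nonneg _)
      refine sub_nonneg.1 ((add_nonneg (sub_nonneg.2 h2) h4).trans_eq ?_)
      have e1 : p * (P + t • (w * star w)) = p + t • (p * (w * star w)) := by
        rw [mul_add, hp, mul_smul_comm]
      have e2 : star (P + t • (w * star w)) * star p = star p + t • (w * star w * star p) := by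
        rw [star_add, hPs, star_smul, star_trivial, star_mul, star_star, add_mul, hPp,
          smul_mul_assoc]
      have e3 : p * ((P + t • (w * star w)) * star (P + t • (w * star w))) * star p =
          (p + t • (p * (w * star w))) * (star p + t • (w * star w * star p)) := by
        rw [← e1, ← e2]; noncomm_ring
      have e4 : p * ((1 + t ^ 2 * K ^ 2) • P) * star p =
          (1 + t ^ 2 * K ^ 2) • (p * star p) := by
        rw [mul_smul_comm, hp, smul_mul_assoc]
      rw [e3, e4]
      simp only [add_mul, mul_add, smul_mul_assoc, mul_smul_comm, star_mul, star_star, mul_assoc]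
      module
    have h5 : 0 ≤ p * (w * star w) * star p :=
      star_right_conjugate_nonneg (mul_star_self_nonneg w) p
    have h6 := CStarAlgebra.norm_le_norm_of_nonneg_of_le
      (smul_nonneg (by positivity : 0 ≤ 2 * t) h5) h3
    rw [norm_smul, norm_smul, Real.norm_of_nonneg (by positivity),
      Real.norm_of_nonneg (by positivity)] at h6
    have : 2 * t * ‖p * (w * star w) * star p‖ ≤ 2 * t * (t * (K ^ 2 / 2 * ‖p * star p‖)) :=
      h6.trans_eq (by ring)
    exact le_of_mul_le_mul_left this (by positivity)
  refine (CStarRing.mul_star_self_eq_zero_iff _).1 ?_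
  rw [← key, star_mul]
  noncomm_ring

theorem IsDualEmbedding.apply_eq (hφ : IsDualEmbedding N φ) (hN : IsHilbertSubmodule A N)
    (hr : IsDualVectorOn A N r) {n : M} (hn : n ∈ N) : φ r n = r n := by
  let H := HermForm.ofHilbert A M
  set z := φ r n + (-1 : ℂ) • r n with hz
  have hzn : z = φ r n - r n := by rw [hz, neg_one_smul, sub_eq_add_neg]
  set h : A := (HermForm.ofHilbert A M).ip n n with hh
  have hhz : h * z = 0 := by
    refine eq_zero_of_forall_norm_le_mul (C := 2 * ‖z‖) fun c hc => ?_
    obtain ⟨u, l, p, hl, -, hlu, -, hl1, hp, hpl⟩ :=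
      exists_cutoff (HermForm.ofHilbert_nonneg A n) hc
    rw [← hh] at hlu hl1 hp hpl
    set g : M := (star (u * r n)) • n with hg
    have hgN : g ∈ N := hN.smulA_mem _ hn
    have hgd := (toDualFun_isDualVector (A := A) g).isDualVectorOn N
    have hng : toDualFun A g n = h * (u * r n) := by
      refine (H.ip_act_right (star (u * r n)) n n).trans ?_
      rw [star_star]
    have hee : H.ip (l • n) (l • n) = l * h * l := by
      have e0 : l • n = H.act l n := rfl
      rw [e0, H.ip_act_left, H.ip_act_right, hl.star_eq, mul_assoc]
    have hσ := hr.add (hgd.smul (-1))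
    have hσn : ∀ x ∈ N, φ (fun x => r x + (-1 : ℂ) • toDualFun A g x) x =
        φ r x + (-1 : ℂ) • toDualFun A g x := fun x _ => by
      rw [hφ.map_add _ _ hr (hgd.smul _), hφ.map_smulC _ _ hgd, hφ.map_toDualFun g hgN]
    have hln := hN.smulA_mem l hn
    have key := hφ.mul_apply_eq_zero hN hσ hln (hee ▸ hl1) (by
      rw [hr.map_smulA l n hn, hgd.map_smulA l n hn, hng, neg_one_smul, ← mul_assoc, ← mul_assoc,
        hlu, add_neg_cancel]) (p := p) (by rw [hee, hp])
    have e1 : φ (fun x => r x + (-1 : ℂ) • toDualFun A g x) (l • n) = l * z := by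
      rw [hσn _ hln, (hφ.isDualVector r hr).map_smulA, hgd.map_smulA l n hn, hng, hzn,
        neg_one_smul, ← mul_assoc, ← mul_assoc, hlu, mul_sub, sub_eq_add_neg]
    rw [e1] at key
    calc ‖h * z‖ = ‖(h - p * l) * z‖ := by rw [sub_mul, mul_assoc p, key, sub_zero]
      _ ≤ ‖h - p * l‖ * ‖z‖ := norm_mul_le _ _
      _ ≤ 2 * c * ‖z‖ := by gcongr
      _ = c * (2 * ‖z‖) := by ring
  have hd := ((hφ.isDualVector r hr).isDualVectorOn N).add (hr.smul (-1))
  obtain ⟨K, -, hK⟩ := hd.exists_pos_bound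
  have h1 := star_left_conjugate_le_conjugate (hd.mul_star_le hN hK hn) z
  rw [← hz, mul_smul_comm, smul_mul_assoc, mul_assoc (star z) ((HermForm.ofHilbert A M).ip n n),
    ← hh, hhz, mul_zero, smul_zero] at h1
  have h2 : star z * (z * star z) * z = star (star z * z) * (star z * z) := by
    rw [star_mul, star_star]; noncomm_ring
  rw [h2] at h1
  have h3 := le_antisymm h1 (star_mul_self_nonneg _)
  rw [CStarRing.star_mul_self_eq_zero_iff, CStarRing.star_mul_self_eq_zero_iff, hzn] at h3
  exact sub_eq_zero.1 h3

end Extension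

section Orthogonal
variable {A : Type*} [NonUnitalCStarAlgebra A] [PartialOrder A] [StarOrderedRing A]
  {M : Type*} [NormedAddCommGroup M] [NormedSpace ℂ M] [SMul A M] [HilbertCStarModule A M]
  {N : Set M} {r : M → A} {φ : (M → A) → (M → A)}

omit [PartialOrder A] [StarOrderedRing A] in
theorem norm_sq_add_smul_le_of_mem_orthComp {n x : M} (hn : n ∈ N)
    (hx : x ∈ orthComp A N) (ε : ℝ) (a : A) :
    ‖n + (ε : ℂ) • a • x‖ ^ 2 ≤ ‖n‖ ^ 2 + ε ^ 2 * (‖a‖ * ‖x‖) ^ 2 := by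
  let H := HermForm.ofHilbert A M
  have h0 : H.ip x n = 0 := hx n hn
  have h1 : H.ip n x = 0 := by rw [H.ip_conj, h0, star_zero]
  have e0 : a • x = H.act a x := rfl
  rw [HermForm.ofHilbert_norm_sq A, HermForm.ofHilbert_norm_sq A n, mul_pow,
    HermForm.ofHilbert_norm_sq A x, e0]
  change ‖H.ip _ _‖ ≤ ‖H.ip n n‖ + ε ^ 2 * (‖a‖ ^ 2 * ‖H.ip x x‖)
  have e1 : H.ip (n + (ε : ℂ) • H.act a x) (n + (ε : ℂ) • H.act a x) =
      H.ip n n + (ε ^ 2) • (a * H.ip x x * star a) := by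
    simp only [H.ip_add_left, H.ip_add_right, H.ip_real_smul_left, H.ip_real_smul_right,
      H.ip_act_left, H.ip_act_right, h0, h1, mul_zero, zero_mul, smul_zero, add_zero, zero_add,
      smul_smul, sq, mul_assoc]
  rw [e1]
  refine (norm_add_le _ _).trans (add_le_add_right ?_ _)
  rw [norm_smul, Real.norm_of_nonneg (sq_nonneg ε)]
  refine mul_le_mul_of_nonneg_left (norm_mul₃_le.trans_eq ?_) (sq_nonneg ε)
  rw [norm_star]; ring

theorem IsDualEmbedding.apply_eq_zero (hφ : IsDualEmbedding N φ) (hN : IsHilbertSubmodule A N)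
    (hr : IsDualVectorOn A N r) {x : M} (hx : x ∈ orthComp A N) : φ r x = 0 := by
  set z := φ r x with hz
  rw [← CStarRing.star_mul_self_eq_zero_iff]
  refine eq_zero_of_forall_norm_le_mul (C := 2) fun c hc => ?_
  obtain ⟨u, l, p, -, hb, -, hub, -, -, hkb⟩ := exists_cutoff (star_mul_self_nonneg z) hc
  set b := p * l
  suffices hb0 : b = 0 by
    rw [hb0, sub_zero] at hkb
    linarith
  have hρ := hr.mul_right (star b)
  have hd := hφ.isDualVector r hr
  have hφρ : ∀ y, φ (fun y => r y * star b) y = φ r y * b := fun y => by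
    rw [hφ.map_smulA b r hr, hb.star_eq]
  set K := dualNormOn A N fun y => r y * star b with hK
  have hK0 : 0 ≤ K := dualNormOn_nonneg _ _
  have hKM : ∀ y, ‖φ r y * b‖ ≤ K * ‖y‖ := fun y => by
    rw [← hφρ, hK, ← hφ.norm_eq _ hρ]
    exact norm_le_dualNorm (hφ.isDualVector _ hρ) y
  obtain ⟨L, hL0, hL⟩ := hr.exists_pos_bound
  set C : ℝ := (L * ‖u‖ * ‖star z‖ * ‖x‖) ^ 2 with hC
  have hC0 : 0 ≤ C := sq_nonneg _
  set ε : ℝ := 1 / (C + 1) with hε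
  have hε0 : 0 < ε := by positivity
  have hεC : ε * (C + 1) = 1 := one_div_mul_cancel (by positivity)
  set q : ℝ := √(1 + ε ^ 2 * C) / (1 + ε) with hq
  have hq1 : q < 1 := by
    rw [hq, div_lt_one (by positivity), Real.sqrt_lt' (by positivity)]
    nlinarith
  have hKq : K ≤ q * K := by
    refine dualNormOn_le (by positivity) fun n hn => ?_
    set a := r n * u * star z with ha
    have h1 : φ r (n + (ε : ℂ) • a • x) * b = ((1 + ε : ℝ) : ℂ) • (r n * b) := by
      rw [hd.map_add, hd.map_smulC, hd.map_smulA, hφ.apply_eq hN hr hn, ← hz, add_mul,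
        smul_mul_assoc, ha]
      have : r n * u * star z * z * b = r n * b := by
        conv_rhs => rw [← hub]
        noncomm_ring
      rw [this, Complex.coe_smul, Complex.coe_smul, add_smul, one_smul]
    have h2 : ‖a‖ * ‖x‖ ≤ L * ‖u‖ * ‖star z‖ * ‖x‖ * ‖n‖ := by
      calc ‖a‖ * ‖x‖ ≤ ‖r n‖ * ‖u‖ * ‖star z‖ * ‖x‖ := by gcongr; exact norm_mul₃_le
        _ ≤ L * ‖n‖ * ‖u‖ * ‖star z‖ * ‖x‖ := by gcongr; exact hL n hn
        _ = _ := by ring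
    have h3 : ‖n + (ε : ℂ) • a • x‖ ≤ √(1 + ε ^ 2 * C) * ‖n‖ := by
      refine le_of_sq_le_sq ?_ (by positivity)
      rw [mul_pow, Real.sq_sqrt (by positivity)]
      refine (norm_sq_add_smul_le_of_mem_orthComp hn hx ε a).trans ?_
      have := pow_le_pow_left₀ (by positivity) h2 2
      rw [mul_pow _ ‖n‖, ← hC] at this
      nlinarith [sq_nonneg ε]
    have h4 := (hKM (n + (ε : ℂ) • a • x)).trans (mul_le_mul_of_nonneg_left h3 hK0)
    rw [h1, norm_smul, Complex.norm_real, Real.norm_of_nonneg (by positivity)] at h4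
    rw [hb.star_eq, hq, div_mul_eq_mul_div, div_mul_eq_mul_div, le_div_iff₀ (by positivity)]
    linarith
  have hK00 : K = 0 := by nlinarith
  have hzb : z * b = 0 := by
    have := hKM x
    rwa [hK00, zero_mul, norm_le_zero_iff] at this
  rw [← hub, mul_assoc, mul_assoc, hzb, mul_zero, mul_zero]

end Orthogonal

/-- For a C*-algebra `A`, the existence (for every pair `N ⊆ M` of a Hilbert
`A`-module and a Hilbert `A`-submodule) of an isometric `A`-linear embedding `φ : N' → M'`
extending the canonical embedding of `N` into `M'` is equivalent to the Hahn-Banach type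
extension property for bounded `A`-linear maps `N → A`. -/
theorem dual_embedding_iff_extension_property
    (A : Type u) [NonUnitalCStarAlgebra A] :
    (∀ (M : Type v) [NormedAddCommGroup M] [NormedSpace ℂ M] [SMul A M]
        [HilbertCStarModule A M] (N : Set M), IsHilbertSubmodule A N →
      ∃ φ : (M → A) → (M → A),
        (∀ r : M → A, IsDualVectorOn A N r → IsDualVector A (φ r)) ∧
        (∀ r s : M → A, IsDualVectorOn A N r → IsDualVectorOn A N s →
          (∀ x ∈ N, r x = s x) → φ r = φ s) ∧
        (∀ r s : M → A, IsDualVectorOn A N r → IsDualVectorOn A N s →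
          φ (fun x => r x + s x) = fun x => φ r x + φ s x) ∧
        (∀ (c : ℂ) (r : M → A), IsDualVectorOn A N r →
          φ (fun x => c • r x) = fun x => c • φ r x) ∧
        (∀ (a : A) (r : M → A), IsDualVectorOn A N r →
          φ (fun x => r x * star a) = fun x => φ r x * star a) ∧
        (∀ r : M → A, IsDualVectorOn A N r → dualNorm A (φ r) = dualNormOn A N r) ∧
        (∀ n ∈ N, φ (toDualFun A n) = toDualFun A n)) ↔
    (∀ (M : Type v) [NormedAddCommGroup M] [NormedSpace ℂ M] [SMul A M]
        [HilbertCStarModule A M] (N : Set M), IsHilbertSubmodule A N →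
      ∀ r : M → A, IsDualVectorOn A N r →
        ∃ r' : M → A, IsDualVector A r' ∧ dualNorm A r' = dualNormOn A N r ∧
          (∀ x ∈ N, r' x = r x) ∧ (∀ x ∈ orthComp A N, r' x = 0)) := by
  let _ := CStarAlgebra.spectralOrder A
  have := CStarAlgebra.spectralOrderedRing A
  constructor
  · intro h M _ _ _ _ N hN r hr
    obtain ⟨φ, h₁, h₂, h₃, h₄, h₅, h₆, h₇⟩ := h M N hN
    have hφ : IsDualEmbedding N φ := ⟨h₁, h₂, h₃, h₄, h₅, h₆, h₇⟩
    exact ⟨φ r, h₁ r hr, h₆ r hr, fun x hx => hφ.apply_eq hN hr hx,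
      fun x hx => hφ.apply_eq_zero hN hr hx⟩
  · intro h M _ _ _ _ N hN
    obtain ⟨φ, h₁, h₂, h₃, h₄, h₅, h₆, h₇⟩ := exists_dual_embedding h hN
    exact ⟨φ, h₁, h₂, h₃, h₄, h₅, h₆, h₇⟩
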